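/- arXiv:2512.20373 — 10 statements merged into one kernel-verified Lean document; each statement's English description precedes it below -/
import Mathlib

section
/- For every r > 0 the integral G(r) = ∫₀^r g(s)/s ds converges, and one has g(r)/α₂ ≤ G(r) ≤ g(r)/α₁. -/
/-- For every `r > 0` the integral `G(r) = ∫₀^r g(s)/s ds` converges,
and one has `g(r)/α₂ ≤ G(r) ≤ g(r)/α₁`. -/
theorem G_integral_converges_and_bounds
    (α₁ α₂ : ℝ) (g g' : ℝ → ℝ)
    (hα₁ : 0 < α₁) (hα₁₂ : α₁ ≤ α₂)
    (hgc : ContinuousOn g (Set.Ici 0))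
    (hgd : ∀ s ∈ Set.Ioi (0:ℝ), HasDerivAt g (g' s) s)
    (hg'c : ContinuousOn g' (Set.Ioi 0))
    (hg0 : g 0 = 0)
    (hgpos : ∀ s, 0 < s → 0 < g s)
    (hlow : ∀ s, 0 < s → α₁ * g s / s ≤ g' s)
    (hupp : ∀ s, 0 < s → g' s ≤ α₂ * g s / s)
    (r : ℝ) (hr : 0 < r) :
    IntervalIntegrable (fun s => g s / s) MeasureTheory.volume 0 r ∧
    g r / α₂ ≤ ∫ s in (0:ℝ)..r, g s / s ∧
    (∫ s in (0:ℝ)..r, g s / s) ≤ g r / α₁ := by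
  have hα₂ : 0 < α₂ := hα₁.trans_le hα₁₂
  have hcont : ContinuousOn g (Set.Icc 0 r) := hgc.mono fun x hx => hx.1
  have hderiv : ∀ x ∈ Set.Ioo 0 r, HasDerivAt g (g' x) x := fun x hx => hgd x hx.1
  have hpos : ∀ s, 0 < s → 0 ≤ g s / s := fun s hs => (div_pos (hgpos s hs) hs).le
  have hg'int : IntervalIntegrable g' MeasureTheory.volume 0 r := by
    rw [intervalIntegrable_iff_integrableOn_Ioc_of_le hr.le]
    refine intervalIntegral.integrableOn_deriv_of_nonneg hcont hderiv fun x hx => ?_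
    refine le_trans ?_ (hlow x hx.1)
    rw [mul_div_assoc]
    exact mul_nonneg hα₁.le (hpos x hx.1)
  have hint : IntervalIntegrable (fun s => g s / s) MeasureTheory.volume 0 r := by
    refine (hg'int.div_const α₁).mono_fun' ?_ ?_
    · rw [Set.uIoc_of_le hr.le]
      refine ContinuousOn.aestronglyMeasurable ?_ measurableSet_Ioc
      exact (hgc.mono fun x hx => hx.1.le).div continuousOn_id fun x hx => hx.1.ne'
    · rw [Set.uIoc_of_le hr.le]
      refine (MeasureTheory.ae_restrict_mem measurableSet_Ioc).mono fun x hx => ?_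
      beta_reduce
      rw [Real.norm_of_nonneg (hpos x hx.1), le_div_iff₀' hα₁, ← mul_div_assoc]
      exact hlow x hx.1
  have hftc : ∫ s in (0:ℝ)..r, g' s = g r := by
    rw [intervalIntegral.integral_eq_sub_of_hasDerivAt_of_le hr.le hcont hderiv hg'int, hg0,
      sub_zero]
  refine ⟨hint, ?_, ?_⟩
  · rw [div_le_iff₀' hα₂, ← hftc, ← intervalIntegral.integral_const_mul]
    refine intervalIntegral.integral_mono_on_of_le_Ioo hr.le hg'int (hint.const_mul α₂)
      fun x hx => ?_
    rw [← mul_div_assoc]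
    exact hupp x hx.1
  · rw [le_div_iff₀' hα₁, ← hftc, ← intervalIntegral.integral_const_mul]
    refine intervalIntegral.integral_mono_on_of_le_Ioo hr.le (hint.const_mul α₁) hg'int
      fun x hx => ?_
    rw [← mul_div_assoc]
    exact hlow x hx.1
end

section
/- The function G is strictly increasing on (0,∞) and its inverse G⁻¹ satisfies, for every r > 0 and every λ ≥ 1, the inequalities λ^{1/α₂} · G⁻¹(r) ≤ G⁻¹(λ·r) ≤ λ^{1/α₁} · G⁻¹(r). -/
theorem hasDerivAt_mul_rpow_neg {g : ℝ → ℝ} {d s : ℝ} (α : ℝ) (hs : 0 < s)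
    (hg : HasDerivAt g d s) :
    HasDerivAt (fun t => g t * t ^ (-α)) (s ^ (-α) * (d - α * g s / s)) s := by
  have h := hg.mul (Real.hasDerivAt_rpow_const (p := -α) (Or.inl hs.ne'))
  refine h.congr_deriv ?_
  rw [Real.rpow_sub hs, Real.rpow_one]
  field_simp
  ring

theorem rpow_mul_le_apply_mul {g g' : ℝ → ℝ} {α c t : ℝ}
    (hgd : ∀ s ∈ Set.Ioi (0 : ℝ), HasDerivAt g (g' s) s)
    (hlow : ∀ s, 0 < s → α * g s / s ≤ g' s) (hc : 1 ≤ c) (ht : 0 < t) :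
    c ^ α * g t ≤ g (c * t) := by
  have hmono : MonotoneOn (fun s => g s * s ^ (-α)) (Set.Ioi 0) := by
    refine monotoneOn_of_hasDerivWithinAt_nonneg (convex_Ioi 0)
      (fun s hs => (hasDerivAt_mul_rpow_neg α hs (hgd s hs)).continuousAt.continuousWithinAt)
      (fun s hs => (hasDerivAt_mul_rpow_neg α (interior_subset hs)
        (hgd s (interior_subset hs))).hasDerivWithinAt) fun s hs => ?_
    have hs' : 0 < s := interior_subset hs
    exact mul_nonneg (Real.rpow_nonneg hs'.le _) (sub_nonneg.2 (hlow s hs'))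
  have hc0 : 0 < c := by linarith
  have h := hmono (Set.mem_Ioi.2 ht) (Set.mem_Ioi.2 (mul_pos hc0 ht))
    (le_mul_of_one_le_left ht.le hc)
  have h1 : 0 < t ^ α := Real.rpow_pos_of_pos ht _
  have h2 : 0 < c ^ α := Real.rpow_pos_of_pos hc0 _
  simp only [Real.rpow_neg ht.le, Real.rpow_neg (mul_pos hc0 ht).le,
    Real.mul_rpow hc0.le ht.le] at h
  rw [← div_eq_mul_inv, ← div_eq_mul_inv, div_le_div_iff₀ h1 (by positivity)] at h
  nlinarith

theorem apply_mul_le_rpow_mul {g g' : ℝ → ℝ} {α c t : ℝ}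
    (hgd : ∀ s ∈ Set.Ioi (0 : ℝ), HasDerivAt g (g' s) s)
    (hupp : ∀ s, 0 < s → g' s ≤ α * g s / s) (hc : 1 ≤ c) (ht : 0 < t) :
    g (c * t) ≤ c ^ α * g t := by
  have h := rpow_mul_le_apply_mul (g := fun s => -g s) (g' := fun s => -g' s) (α := α)
    (fun s hs => (hgd s hs).neg)
    (fun s hs => by rw [mul_neg, neg_div]; exact neg_le_neg (hupp s hs)) hc ht
  linarith

theorem intervalIntegrable_div_self {g g' : ℝ → ℝ} {α : ℝ} (hα : 0 < α)
    (hgc : ContinuousOn g (Set.Ici 0))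
    (hgd : ∀ s ∈ Set.Ioi (0 : ℝ), HasDerivAt g (g' s) s)
    (hgpos : ∀ s, 0 < s → 0 < g s)
    (hlow : ∀ s, 0 < s → α * g s / s ≤ g' s) {r : ℝ} (hr : 0 ≤ r) :
    IntervalIntegrable (fun s => g s / s) MeasureTheory.volume 0 r := by
  rw [intervalIntegrable_iff_integrableOn_Ioc_of_le hr]
  have hg' : MeasureTheory.IntegrableOn g' (Set.Ioc 0 r) :=
    intervalIntegral.integrableOn_deriv_of_nonneg (hgc.mono Set.Icc_subset_Ici_self)
      (fun s hs => hgd s hs.1) fun s hs =>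
        (div_pos (mul_pos hα (hgpos s hs.1)) hs.1).le.trans (hlow s hs.1)
  refine (hg'.const_mul α⁻¹).mono' ?_ ?_
  · exact ((hgc.mono fun s hs => hs.1.le).div continuousOn_id
      fun s hs => hs.1.ne').aestronglyMeasurable measurableSet_Ioc
  · filter_upwards [MeasureTheory.ae_restrict_mem measurableSet_Ioc] with s hs
    rw [Real.norm_of_nonneg (div_pos (hgpos s hs.1) hs.1).le, inv_mul_eq_div, le_div_iff₀ hα]
    have := hlow s hs.1
    rwa [mul_div_assoc, mul_comm] at this

theorem integral_div_self_comp_mul_left (g : ℝ → ℝ) {c : ℝ} (hc : c ≠ 0) (x : ℝ) :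
    ∫ s in (0 : ℝ)..(c * x), g s / s = ∫ t in (0 : ℝ)..x, g (c * t) / t := by
  have h := intervalIntegral.mul_integral_comp_mul_left (a := 0) (b := x)
    (f := fun s => g s / s) c
  rw [mul_zero, ← intervalIntegral.integral_const_mul] at h
  rw [← h]
  refine intervalIntegral.integral_congr fun t _ => ?_
  change c * (g (c * t) / (c * t)) = g (c * t) / t
  rw [← mul_div_assoc, mul_div_mul_left _ _ hc]

/-- `G` is strictly increasing on `(0,∞)` and its inverse `G⁻¹`
satisfies, for every `r > 0` and `λ ≥ 1`,
`λ^{1/α₂}·G⁻¹(r) ≤ G⁻¹(λ·r) ≤ λ^{1/α₁}·G⁻¹(r)`. -/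
theorem G_strictMono_and_inverse_doubling
    (α₁ α₂ : ℝ) (g g' : ℝ → ℝ)
    (hα₁ : 0 < α₁) (hα₁₂ : α₁ ≤ α₂)
    (hgc : ContinuousOn g (Set.Ici 0))
    (hgd : ∀ s ∈ Set.Ioi (0:ℝ), HasDerivAt g (g' s) s)
    (hg'c : ContinuousOn g' (Set.Ioi 0))
    (hg0 : g 0 = 0)
    (hgpos : ∀ s, 0 < s → 0 < g s)
    (hlow : ∀ s, 0 < s → α₁ * g s / s ≤ g' s)
    (hupp : ∀ s, 0 < s → g' s ≤ α₂ * g s / s)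
    (G Ginv : ℝ → ℝ) (hG : ∀ r, G r = ∫ s in (0:ℝ)..r, g s / s)
    (hGinv : ∀ r, 0 ≤ r → Ginv (G r) = r)
    (hGinv' : ∀ τ, 0 ≤ τ → 0 ≤ Ginv τ ∧ G (Ginv τ) = τ) :
    StrictMonoOn G (Set.Ioi 0) ∧
    ∀ r, 0 < r → ∀ lam : ℝ, 1 ≤ lam →
      lam ^ (1/α₂) * Ginv r ≤ Ginv (lam * r) ∧
      Ginv (lam * r) ≤ lam ^ (1/α₁) * Ginv r := by
  have hint : ∀ r, 0 ≤ r → IntervalIntegrable (fun s => g s / s) MeasureTheory.volume 0 r :=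
    fun r => intervalIntegrable_div_self hα₁ hgc hgd hgpos hlow
  have hmono : StrictMonoOn G (Set.Ici 0) := by
    intro a ha b hb hab
    have ha' : 0 ≤ a := ha
    have hab_int := (hint a ha).symm.trans (hint b hb)
    have hpos := intervalIntegral.intervalIntegral_pos_of_pos_on hab_int
      (fun s hs => div_pos (hgpos s (ha'.trans_lt hs.1)) (ha'.trans_lt hs.1)) hab
    rw [hG, hG, ← intervalIntegral.integral_add_adjacent_intervals (hint a ha) hab_int]
    linarith
  have hint_mul : ∀ c x, 0 < c → 0 ≤ x →
      IntervalIntegrable (fun t => g (c * t) / t) MeasureTheory.volume 0 x := by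
    intro c x hc hx
    have h := ((hint (c * x) (by positivity)).comp_mul_left (c := c)).const_mul c
    rw [zero_div, mul_div_cancel_left₀ x hc.ne'] at h
    refine h.congr fun t _ => ?_
    change c * (g (c * t) / (c * t)) = g (c * t) / t
    rw [← mul_div_assoc, mul_div_mul_left _ _ hc.ne']
  have hscale : ∀ c x, 1 ≤ c → 0 ≤ x → c ^ α₁ * G x ≤ G (c * x) ∧ G (c * x) ≤ c ^ α₂ * G x := by
    intro c x hc hx
    have hc0 : 0 < c := by linarith
    rw [hG, hG, integral_div_self_comp_mul_left g hc0.ne', ← intervalIntegral.integral_const_mul,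
      ← intervalIntegral.integral_const_mul]
    constructor
    · refine intervalIntegral.integral_mono_on_of_le_Ioo hx ((hint x hx).const_mul _)
        (hint_mul c x hc0 hx) fun t ht => ?_
      rw [← mul_div_assoc]
      exact div_le_div_of_nonneg_right (rpow_mul_le_apply_mul hgd hlow hc ht.1) ht.1.le
    · refine intervalIntegral.integral_mono_on_of_le_Ioo hx (hint_mul c x hc0 hx)
        ((hint x hx).const_mul _) fun t ht => ?_
      rw [← mul_div_assoc]
      exact div_le_div_of_nonneg_right (apply_mul_le_rpow_mul hgd hupp hc ht.1) ht.1.le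
  refine ⟨hmono.mono Set.Ioi_subset_Ici_self, fun r hr lam hlam => ?_⟩
  have hα₂ : 0 < α₂ := hα₁.trans_le hα₁₂
  have hlam0 : 0 ≤ lam := by linarith
  obtain ⟨hx, hGx⟩ := hGinv' r hr.le
  obtain ⟨hz, hGz⟩ := hGinv' (lam * r) (by positivity)
  have hroot : ∀ α : ℝ, 0 < α → (lam ^ (1 / α)) ^ α = lam := fun α hα => by
    rw [← Real.rpow_mul hlam0, one_div_mul_cancel hα.ne', Real.rpow_one]
  have hy : ∀ α : ℝ, lam ^ (1 / α) * Ginv r ∈ Set.Ici (0 : ℝ) :=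
    fun α => mul_nonneg (Real.rpow_nonneg hlam0 _) hx
  constructor
  · rw [← hmono.le_iff_le (hy α₂) hz, hGz]
    have h := (hscale _ _ (Real.one_le_rpow hlam (one_div_pos.2 hα₂).le) hx).2
    rwa [hroot α₂ hα₂, hGx] at h
  · rw [← hmono.le_iff_le hz (hy α₁), hGz]
    have h := (hscale _ _ (Real.one_le_rpow hlam (one_div_pos.2 hα₁).le) hx).1
    rwa [hroot α₁ hα₁, hGx] at h
end

section
/- G is twice differentiable on (0,∞) with G''(r) = (r·g'(r) − g(r))/r², and for every r > 0 one has η₁·G(r) ≤ r²·G''(r) ≤ η₂·G(r), where η₁ = (α₁−1)α₂ if α₁ < 1 and η₁ = (α₁−1)α₁ if α₁ ≥ 1, and η₂ = (α₂−1)α₁ if α₂ < 1 and η₂ = (α₂−1)α₂ if α₂ ≥ 1. -/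
open MeasureTheory Set in
/-- Integrating the lower bound `α * g s / s ≤ g' s` of a nonnegative `g` shows that `g s / s` is
integrable at `0`, because `g'` is. -/
theorem intervalIntegrable_div_self_of_le_deriv {α : ℝ} {g g' : ℝ → ℝ} (hα : 0 < α)
    (hgc : ContinuousOn g (Ici 0)) (hgd : ∀ s ∈ Ioi (0 : ℝ), HasDerivAt g (g' s) s)
    (hgnn : ∀ s, 0 < s → 0 ≤ g s) (hlow : ∀ s, 0 < s → α * g s / s ≤ g' s)
    {x : ℝ} (hx : 0 < x) :
    IntervalIntegrable g' volume 0 x ∧ IntervalIntegrable (fun s => g s / s) volume 0 x := by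
  have hnn : ∀ s, 0 < s → 0 ≤ g' s := fun s hs =>
    (div_nonneg (mul_nonneg hα.le (hgnn s hs)) hs.le).trans (hlow s hs)
  have hg'i : IntervalIntegrable g' volume 0 x := by
    apply intervalIntegral.intervalIntegrable_deriv_of_nonneg (g := g)
    · rw [uIcc_of_le hx.le]
      exact hgc.mono Icc_subset_Ici_self
    · intro s hs
      rw [min_eq_left hx.le] at hs
      exact hgd s hs.1
    · intro s hs
      rw [min_eq_left hx.le] at hs
      exact hnn s hs.1
  refine ⟨hg'i, (hg'i.const_mul α⁻¹).mono_fun ?_ ?_⟩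
  · rw [uIoc_of_le hx.le]
    refine ContinuousOn.aestronglyMeasurable ?_ measurableSet_Ioc
    exact (hgc.mono fun s hs => hs.1.le).div continuousOn_id fun s hs => hs.1.ne'
  · rw [uIoc_of_le hx.le]
    refine (ae_restrict_iff' measurableSet_Ioc).2 (Filter.Eventually.of_forall fun s hs => ?_)
    beta_reduce
    rw [Real.norm_of_nonneg (div_nonneg (hgnn s hs.1) hs.1.le),
      Real.norm_of_nonneg (mul_nonneg (inv_nonneg.2 hα.le) (hnn s hs.1)), inv_mul_eq_div,
      le_div_iff₀' hα, ← mul_div_assoc]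
    exact hlow s hs.1


/-- `G` is twice differentiable on `(0,∞)` with
`G''(r) = (r·g'(r) − g(r))/r²`, and `η₁·G(r) ≤ r²·G''(r) ≤ η₂·G(r)` with the
constants `η₁`, `η₂` depending on the position of `α₁`, `α₂` relative to `1`. -/
theorem G_second_derivative_bounds
    (α₁ α₂ : ℝ) (g g' : ℝ → ℝ)
    (hα₁ : 0 < α₁) (hα₁₂ : α₁ ≤ α₂)
    (hgc : ContinuousOn g (Set.Ici 0))
    (hgd : ∀ s ∈ Set.Ioi (0:ℝ), HasDerivAt g (g' s) s)
    (hg'c : ContinuousOn g' (Set.Ioi 0))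
    (hg0 : g 0 = 0)
    (hgpos : ∀ s, 0 < s → 0 < g s)
    (hlow : ∀ s, 0 < s → α₁ * g s / s ≤ g' s)
    (hupp : ∀ s, 0 < s → g' s ≤ α₂ * g s / s)
    (G : ℝ → ℝ) (hG : ∀ r, G r = ∫ s in (0:ℝ)..r, g s / s)
    (r : ℝ) (hr : 0 < r) :
    HasDerivAt G (g r / r) r ∧
    HasDerivAt (deriv G) ((r * g' r - g r) / r ^ 2) r ∧
    (if α₁ < 1 then (α₁ - 1) * α₂ else (α₁ - 1) * α₁) * G r
      ≤ r ^ 2 * ((r * g' r - g r) / r ^ 2) ∧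
    r ^ 2 * ((r * g' r - g r) / r ^ 2)
      ≤ (if α₂ < 1 then (α₂ - 1) * α₁ else (α₂ - 1) * α₂) * G r := by
  have hint : ∀ x, 0 < x → IntervalIntegrable g' MeasureTheory.volume 0 x ∧
      IntervalIntegrable (fun s => g s / s) MeasureTheory.volume 0 x := fun x hx =>
    intervalIntegrable_div_self_of_le_deriv hα₁ hgc hgd (fun s hs => (hgpos s hs).le) hlow hx
  have hcont : ContinuousOn (fun s => g s / s) (Set.Ioi 0) :=
    (hgc.mono Set.Ioi_subset_Ici_self).div continuousOn_id fun s hs => (Set.mem_Ioi.1 hs).ne'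
  have hG' : ∀ x, 0 < x → HasDerivAt G (g x / x) x := by
    intro x hx
    rw [funext hG]
    exact intervalIntegral.integral_hasDerivAt_right (hint x hx).2
      (hcont.stronglyMeasurableAtFilter isOpen_Ioi x hx) (hcont.continuousAt (Ioi_mem_nhds hx))
  have hFTC : ∫ s in (0:ℝ)..r, g' s = g r := by
    rw [intervalIntegral.integral_eq_sub_of_hasDerivAt_of_le hr.le
      (hgc.mono Set.Icc_subset_Ici_self) (fun s hs => hgd s hs.1) (hint r hr).1, hg0, sub_zero]
  have hlowG : α₁ * G r ≤ g r := by
    rw [hG, ← hFTC, ← intervalIntegral.integral_const_mul]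
    refine intervalIntegral.integral_mono_on_of_le_Ioo hr.le ((hint r hr).2.const_mul α₁)
      (hint r hr).1 fun s hs => ?_
    rw [← mul_div_assoc]
    exact hlow s hs.1
  have huppG : g r ≤ α₂ * G r := by
    rw [hG, ← hFTC, ← intervalIntegral.integral_const_mul]
    refine intervalIntegral.integral_mono_on_of_le_Ioo hr.le (hint r hr).1
      ((hint r hr).2.const_mul α₂) fun s hs => ?_
    rw [← mul_div_assoc]
    exact hupp s hs.1
  have hlow' : α₁ * g r ≤ r * g' r := (div_le_iff₀' hr).1 (hlow r hr)
  have hupp' : r * g' r ≤ α₂ * g r := (le_div_iff₀' hr).1 (hupp r hr)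
  refine ⟨hG' r hr, ?_, ?_, ?_⟩
  · have heq : deriv G =ᶠ[nhds r] fun s => g s / s := by
      filter_upwards [Ioi_mem_nhds hr] with s hs using (hG' s hs).deriv
    refine HasDerivAt.congr_of_eventuallyEq ?_ heq
    have hdiv := (hgd r hr).fun_div (hasDerivAt_id' r) hr.ne'
    rwa [mul_one, mul_comm] at hdiv
  · rw [mul_div_cancel₀ _ (pow_ne_zero 2 hr.ne')]
    split_ifs with h
    · nlinarith
    · nlinarith
  · rw [mul_div_cancel₀ _ (pow_ne_zero 2 hr.ne')]
    split_ifs with h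
    · nlinarith
    · nlinarith
end

section
/- For every r > 0, the function J is differentiable at r with J'(r) = (J(r)/r)·(p − r·G'(r)/G(r)), and one has (p − α₂)·J(r)/r ≤ J'(r) ≤ (p − α₁)·J(r)/r. -/
/-- If `g` is positive on `(0, ∞)` and `a * g s / s ≤ g' s` with `a > 0`, then both `g'` and
`g s / s` are integrable up to `0`. -/
theorem intervalIntegrable_of_deriv_bounds {a r : ℝ} {g g' : ℝ → ℝ} (ha : 0 < a)
    (hgc : ContinuousOn g (Set.Ici 0))
    (hgd : ∀ s ∈ Set.Ioi (0 : ℝ), HasDerivAt g (g' s) s)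
    (hgpos : ∀ s, 0 < s → 0 < g s)
    (hlow : ∀ s, 0 < s → a * g s / s ≤ g' s) (hr : 0 < r) :
    IntervalIntegrable g' MeasureTheory.volume 0 r ∧
    IntervalIntegrable (fun s => g s / s) MeasureTheory.volume 0 r := by
  have hint : IntervalIntegrable g' MeasureTheory.volume 0 r := by
    rw [intervalIntegrable_iff_integrableOn_Ioc_of_le hr.le]
    refine intervalIntegral.integrableOn_deriv_of_nonneg (g := g)
      (hgc.mono Set.Icc_subset_Ici_self) (fun x hx => hgd x hx.1) fun x hx => ?_
    have := hgpos x hx.1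
    have := hx.1
    exact le_trans (by positivity) (hlow x hx.1)
  refine ⟨hint, (hint.const_mul a⁻¹).mono_fun' ?_ ?_⟩
  · rw [Set.uIoc_of_le hr.le]
    refine ContinuousOn.aestronglyMeasurable ?_ measurableSet_Ioc
    exact (hgc.mono fun x hx => hx.1.le).div continuousOn_id fun x hx => hx.1.ne'
  · rw [Set.uIoc_of_le hr.le]
    filter_upwards [MeasureTheory.ae_restrict_mem measurableSet_Ioc] with x hx
    have hgx := hgpos x hx.1
    have hx0 := hx.1
    rw [Real.norm_of_nonneg (by positivity), le_inv_mul_iff₀ ha, ← mul_div_assoc]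
    exact hlow x hx.1

/-- With `J(r) = r^p/G(r)`, for every `r > 0` the function `J` is
differentiable at `r` with `J'(r) = (J(r)/r)·(p − r·G'(r)/G(r))` (where
`G'(r) = g(r)/r`), and `(p−α₂)·J(r)/r ≤ J'(r) ≤ (p−α₁)·J(r)/r`. -/
theorem J_derivative_and_bounds
    (α₁ α₂ : ℝ) (g g' : ℝ → ℝ)
    (hα₁ : 0 < α₁) (hα₁₂ : α₁ ≤ α₂)
    (hgc : ContinuousOn g (Set.Ici 0))
    (hgd : ∀ s ∈ Set.Ioi (0:ℝ), HasDerivAt g (g' s) s)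
    (hg'c : ContinuousOn g' (Set.Ioi 0))
    (hg0 : g 0 = 0)
    (hgpos : ∀ s, 0 < s → 0 < g s)
    (hlow : ∀ s, 0 < s → α₁ * g s / s ≤ g' s)
    (hupp : ∀ s, 0 < s → g' s ≤ α₂ * g s / s)
    (G : ℝ → ℝ) (hG : ∀ r, G r = ∫ s in (0:ℝ)..r, g s / s)
    (p : ℝ) (J : ℝ → ℝ) (hJ : ∀ r, 0 < r → J r = r ^ p / G r)
    (r : ℝ) (hr : 0 < r) :
    HasDerivAt J (J r / r * (p - r * (g r / r) / G r)) r ∧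
    (p - α₂) * J r / r ≤ J r / r * (p - r * (g r / r) / G r) ∧
    J r / r * (p - r * (g r / r) / G r) ≤ (p - α₁) * J r / r := by
  obtain ⟨hint', hint⟩ := intervalIntegrable_of_deriv_bounds hα₁ hgc hgd hgpos hlow hr
  have hftc : ∫ s in (0:ℝ)..r, g' s = g r := by
    rw [intervalIntegral.integral_eq_sub_of_hasDerivAt_of_le hr.le
      (hgc.mono Set.Icc_subset_Ici_self) (fun x hx => hgd x hx.1) hint', hg0, sub_zero]
  have hG_le : α₁ * G r ≤ g r := by
    rw [hG, ← hftc, ← intervalIntegral.integral_const_mul]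
    refine intervalIntegral.integral_mono_on_of_le_Ioo hr.le (hint.const_mul _) hint' ?_
    intro x hx
    simpa only [mul_div_assoc] using hlow x hx.1
  have hle_G : g r ≤ α₂ * G r := by
    rw [hG, ← hftc, ← intervalIntegral.integral_const_mul]
    refine intervalIntegral.integral_mono_on_of_le_Ioo hr.le hint' (hint.const_mul _) ?_
    intro x hx
    simpa only [mul_div_assoc] using hupp x hx.1
  have hgr := hgpos r hr
  have hGpos : 0 < G r := pos_of_mul_pos_right (hgr.trans_le hle_G) (hα₁.le.trans hα₁₂)
  have hcont : ContinuousOn (fun s => g s / s) (Set.Ioi 0) :=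
    (hgc.mono Set.Ioi_subset_Ici_self).div continuousOn_id fun x hx => ne_of_gt hx
  have hGderiv : HasDerivAt G (g r / r) r := by
    rw [funext hG]
    exact intervalIntegral.integral_hasDerivAt_right hint
      (hcont.stronglyMeasurableAtFilter isOpen_Ioi r hr)
      (hcont.continuousAt (Ioi_mem_nhds hr))
  have hJr : 0 < J r / r := by
    rw [hJ r hr]
    positivity
  have hratio : r * (g r / r) / G r = g r / G r := by rw [mul_div_cancel₀ _ hr.ne']
  refine ⟨?_, ?_, ?_⟩
  · have hquot := (Real.hasDerivAt_rpow_const (p := p) (Or.inl hr.ne')).div hGderiv hGpos.ne'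
    have heq : J =ᶠ[nhds r] (fun x => x ^ p) / G := by
      filter_upwards [Ioi_mem_nhds hr] with x hx using hJ x hx
    refine (hquot.congr_of_eventuallyEq heq).congr_deriv ?_
    rw [hJ r hr, Real.rpow_sub_one hr.ne']
    field_simp
  · rw [hratio, mul_div_assoc, mul_comm]
    gcongr
    exact (div_le_iff₀ hGpos).2 hle_G
  · rw [hratio, mul_div_assoc, mul_comm (p - α₁)]
    gcongr
    exact (le_div_iff₀ hGpos).2 hG_le
end

section
/- Let δ₁ > 0, δ₂ > 0 be constants and define φ(r) = J(r)^{1/(p−1)}·(δ₁ + δ₂/G(r)) for r > 0. Then for every r > 0 such that G(r) ≥ (δ₂/δ₁)·p·(α₂−1)₊/(p−α₂), one has φ'(r) ≥ 0; in particular φ is nondecreasing on the set where G(r) exceeds this threshold. -/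
open MeasureTheory in
/-- If `g' ≥ α g / s` with `α > 0`, then `g s / s` is integrable near `0`. -/
lemma intervalIntegrable_div_of_le_deriv {α : ℝ} {g g' : ℝ → ℝ} (hα : 0 < α)
    (hgc : ContinuousOn g (Set.Ici 0))
    (hgd : ∀ s ∈ Set.Ioi (0:ℝ), HasDerivAt g (g' s) s)
    (hgpos : ∀ s, 0 < s → 0 < g s)
    (hlow : ∀ s, 0 < s → α * g s / s ≤ g' s) {r : ℝ} (hr : 0 < r) :
    IntervalIntegrable g' volume 0 r ∧
      IntervalIntegrable (fun s => g s / s) volume 0 r := by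
  have hg' : IntervalIntegrable g' volume 0 r := by
    rw [intervalIntegrable_iff_integrableOn_Ioc_of_le hr.le]
    refine intervalIntegral.integrableOn_deriv_of_nonneg
      (hgc.mono Set.Icc_subset_Ici_self) (fun x hx => hgd x hx.1) (fun x hx => ?_)
    have := hgpos x hx.1
    have hx0 : 0 < x := hx.1
    exact le_trans (by positivity) (hlow x hx.1)
  refine ⟨hg', ?_⟩
  have hdom := hg'.const_mul α⁻¹
  rw [intervalIntegrable_iff_integrableOn_Ioc_of_le hr.le] at hdom ⊢
  have hcont : ContinuousOn (fun s => g s / s) (Set.Ioc 0 r) :=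
    (hgc.mono (fun x hx => hx.1.le)).div continuousOn_id (fun x hx => hx.1.ne')
  refine Integrable.mono' hdom (hcont.aestronglyMeasurable measurableSet_Ioc) ?_
  refine (ae_restrict_iff' measurableSet_Ioc).2 (Filter.Eventually.of_forall fun x hx => ?_)
  have hx0 : 0 < x := hx.1
  have hgx := hgpos x hx0
  rw [Real.norm_of_nonneg (by positivity), le_inv_mul_iff₀ hα, ← mul_div_assoc]
  exact hlow x hx0

/-- The derivative of `(r ^ p / G r) ^ (1 / (p - 1)) * (δ₁ + δ₂ / G r)`. -/
lemma hasDerivAt_rpow_div_mul {G : ℝ → ℝ} {γ p δ₁ δ₂ r : ℝ} (hr : 0 < r) (hp : 1 < p)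
    (hGr : 0 < G r) (hG : HasDerivAt G (γ / r) r) :
    HasDerivAt (fun x => (x ^ p / G x) ^ (1 / (p - 1)) * (δ₁ + δ₂ / G x))
      ((r ^ p / G r) ^ (1 / (p - 1)) / (r * (p - 1)) *
        ((p - γ / G r) * δ₁ + δ₂ / G r * (p * (1 - γ / G r)))) r := by
  have hrp : 0 < r ^ p := Real.rpow_pos_of_pos hr p
  have hJ : 0 < r ^ p / G r := div_pos hrp hGr
  have hJd := ((Real.hasDerivAt_rpow_const (p := p) (Or.inl hr.ne')).div hG hGr.ne').rpow_const
    (p := 1 / (p - 1)) (Or.inl hJ.ne')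
  have hK := ((hasDerivAt_const r δ₂).div hG hGr.ne').const_add δ₁
  convert! hJd.mul hK using 1
  have hp1 : p - 1 ≠ 0 := by linarith
  simp only [Pi.div_apply]
  rw [Real.rpow_sub_one hJ.ne', Real.rpow_sub_one hr.ne']
  generalize (r ^ p / G r) ^ (1 / (p - 1)) = A
  field_simp
  ring


/-- With `φ(r) = J(r)^{1/(p−1)}·(δ₁ + δ₂/G(r))`, for every `r > 0`
with `G(r) ≥ (δ₂/δ₁)·p·(α₂−1)₊/(p−α₂)` one has `φ'(r) ≥ 0`; in particular `φ`
is nondecreasing on the set where `G` exceeds this threshold. -/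
theorem phi_increasing
    (α₁ α₂ : ℝ) (g g' : ℝ → ℝ)
    (hα₁ : 0 < α₁) (hα₁₂ : α₁ ≤ α₂)
    (hgc : ContinuousOn g (Set.Ici 0))
    (hgd : ∀ s ∈ Set.Ioi (0:ℝ), HasDerivAt g (g' s) s)
    (hg'c : ContinuousOn g' (Set.Ioi 0))
    (hg0 : g 0 = 0)
    (hgpos : ∀ s, 0 < s → 0 < g s)
    (hlow : ∀ s, 0 < s → α₁ * g s / s ≤ g' s)
    (hupp : ∀ s, 0 < s → g' s ≤ α₂ * g s / s)
    (G : ℝ → ℝ) (hG : ∀ r, G r = ∫ s in (0:ℝ)..r, g s / s)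
    (p : ℝ) (hp : 1 < p) (hα₂p : α₂ < p)
    (δ₁ δ₂ : ℝ) (hδ₁ : 0 < δ₁) (hδ₂ : 0 < δ₂)
    (φ : ℝ → ℝ)
    (hφ : ∀ r, 0 < r → φ r = (r ^ p / G r) ^ (1/(p-1)) * (δ₁ + δ₂ / G r)) :
    (∀ r, 0 < r → δ₂ / δ₁ * (p * max (α₂ - 1) 0 / (p - α₂)) ≤ G r →
      ∃ d : ℝ, HasDerivAt φ d r ∧ 0 ≤ d) ∧
    MonotoneOn φ {r : ℝ | 0 < r ∧ δ₂ / δ₁ * (p * max (α₂ - 1) 0 / (p - α₂)) ≤ G r} := by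
  have hint := fun r (hr : 0 < r) =>
    intervalIntegrable_div_of_le_deriv hα₁ hgc hgd hgpos hlow hr
  have hGfun : G = fun r => ∫ s in (0:ℝ)..r, g s / s := funext hG
  have hGpos : ∀ r, 0 < r → 0 < G r := fun r hr => by
    rw [hG]
    exact intervalIntegral.intervalIntegral_pos_of_pos_on (hint r hr).2
      (fun x hx => div_pos (hgpos x hx.1) hx.1) hr
  have hgG : ∀ r, 0 < r → g r ≤ α₂ * G r := fun r hr => by
    have hftc : ∫ s in (0:ℝ)..r, g' s = g r - g 0 :=
      intervalIntegral.integral_eq_sub_of_hasDerivAt_of_le hr.le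
        (hgc.mono Set.Icc_subset_Ici_self) (fun x hx => hgd x hx.1) (hint r hr).1
    rw [hg0, sub_zero] at hftc
    rw [← hftc, hG, ← intervalIntegral.integral_const_mul]
    refine intervalIntegral.integral_mono_on_of_le_Ioo hr.le (hint r hr).1
      ((hint r hr).2.const_mul _) (fun x hx => ?_)
    rw [← mul_div_assoc]
    exact hupp x hx.1
  have hdiv : ContinuousOn (fun s => g s / s) (Set.Ioi 0) :=
    (hgc.mono Set.Ioi_subset_Ici_self).div continuousOn_id (fun x hx => ne_of_gt hx)
  have hGd : ∀ r, 0 < r → HasDerivAt G (g r / r) r := fun r hr => by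
    rw [hGfun]
    exact intervalIntegral.integral_hasDerivAt_right (hint r hr).2
      (hdiv.stronglyMeasurableAtFilter isOpen_Ioi r hr)
      (hdiv.continuousAt (Ioi_mem_nhds hr))
  have hmain : ∀ r, 0 < r → δ₂ / δ₁ * (p * max (α₂ - 1) 0 / (p - α₂)) ≤ G r →
      ∃ d : ℝ, HasDerivAt φ d r ∧ 0 ≤ d := by
    intro r hr hthr
    have hGr := hGpos r hr
    refine ⟨_, (hasDerivAt_rpow_div_mul hr hp hGr (hGd r hr)).congr_of_eventuallyEq
      (Filter.mem_of_superset (Ioi_mem_nhds hr) hφ), ?_⟩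
    have hrp : 0 < r ^ p := Real.rpow_pos_of_pos hr p
    have hp1 : 0 < p - 1 := by linarith
    have hpα : 0 < p - α₂ := by linarith
    refine mul_nonneg (by positivity) ?_
    have ht : g r / G r ≤ α₂ := (div_le_iff₀ hGr).2 (hgG r hr)
    have hthr' : δ₂ / G r * (p * max (α₂ - 1) 0) ≤ (p - α₂) * δ₁ := by
      rw [div_mul_div_comm, div_le_iff₀ (by positivity)] at hthr
      rw [div_mul_eq_mul_div, div_le_iff₀ hGr]
      linarith
    have h1 : (p - α₂) * δ₁ ≤ (p - g r / G r) * δ₁ := by gcongr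
    have h2 : δ₂ / G r * (p * -max (α₂ - 1) 0) ≤ δ₂ / G r * (p * (1 - g r / G r)) := by
      have := le_max_left (α₂ - 1) 0
      gcongr
      linarith
    linarith
  refine ⟨hmain, ?_⟩
  have hGmono : MonotoneOn G (Set.Ioi 0) := by
    refine monotoneOn_of_deriv_nonneg (convex_Ioi 0)
      (fun x hx => (hGd x hx).continuousAt.continuousWithinAt)
      (fun x hx => (hGd x (interior_subset hx)).differentiableAt.differentiableWithinAt)
      (fun x hx => ?_)
    have hx0 : 0 < x := interior_subset hx
    rw [(hGd x hx0).deriv]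
    exact (div_pos (hgpos x hx0) hx0).le
  refine monotoneOn_of_deriv_nonneg (Set.OrdConnected.convex ⟨?_⟩) ?_ ?_ ?_
  · rintro x ⟨hx, hxG⟩ y - z ⟨hxz, -⟩
    exact ⟨hx.trans_le hxz, hxG.trans (hGmono hx (hx.trans_le hxz) hxz)⟩
  · rintro x ⟨hx, hxG⟩
    obtain ⟨d, hd, -⟩ := hmain x hx hxG
    exact hd.continuousAt.continuousWithinAt
  · intro x hx
    obtain ⟨hx, hxG⟩ := interior_subset hx
    obtain ⟨d, hd, -⟩ := hmain x hx hxG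
    exact hd.differentiableAt.differentiableWithinAt
  · intro x hx
    obtain ⟨hx, hxG⟩ := interior_subset hx
    obtain ⟨d, hd, hd0⟩ := hmain x hx hxG
    rwa [hd.deriv]
end

section
/- Fix Γ ≥ 1 and t₀ > 1, and for t ≥ 0 set τ(t) = Γ·log(t+t₀). Then for every t ≥ 0 the function t ↦ E(τ(t))^{1/(p−1)} is differentiable and satisfies ((p−α₂)/(α₂(p−1))) · (Γ/((t+t₀)·τ(t))) · E(τ(t))^{1/(p−1)} ≤ d/dt [E(τ(t))^{1/(p−1)}] ≤ ((p−α₁)/(α₁(p−1))) · (Γ/((t+t₀)·τ(t))) · E(τ(t))^{1/(p−1)}. -/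
open Set Filter Topology

/-- A primitive `∫₀ʳ g(s)/s ds` with a left inverse fixing `0` has integrable integrand, since
the integral of a non-integrable function is `0`. -/
theorem intervalIntegrable_of_leftInverse_primitive {f G Ginv : ℝ → ℝ}
    (hG : ∀ r, G r = ∫ s in (0 : ℝ)..r, f s) (hGinv : ∀ r, 0 ≤ r → Ginv (G r) = r)
    {r : ℝ} (hr : 0 < r) : IntervalIntegrable f MeasureTheory.volume 0 r := by
  by_contra h
  have h₁ := hGinv r hr.le
  have h₂ := hGinv 0 le_rfl
  rw [hG, intervalIntegral.integral_undef h] at h₁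
  rw [hG, intervalIntegral.integral_same] at h₂
  linarith

theorem hasDerivAt_primitive_of_continuousOn_Ioi {f G : ℝ → ℝ}
    (hG : ∀ r, G r = ∫ s in (0 : ℝ)..r, f s) (hf : ContinuousOn f (Ioi 0)) {r : ℝ} (hr : 0 < r)
    (hint : IntervalIntegrable f MeasureTheory.volume 0 r) : HasDerivAt G (f r) r := by
  rw [funext hG]
  exact intervalIntegral.integral_hasDerivAt_right hint
    (hf.stronglyMeasurableAtFilter isOpen_Ioi r hr) (hf.continuousAt (Ioi_mem_nhds hr))

theorem continuousOn_primitive_Ici {f G : ℝ → ℝ}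
    (hG : ∀ r, G r = ∫ s in (0 : ℝ)..r, f s)
    (hint : ∀ r, 0 < r → IntervalIntegrable f MeasureTheory.volume 0 r) :
    ContinuousOn G (Ici 0) := by
  intro r hr
  have hr' : (0 : ℝ) < r + 1 := by linarith [mem_Ici.1 hr]
  have h := intervalIntegral.continuousOn_primitive_interval' (hint _ hr') left_mem_uIcc
  rw [uIcc_of_le hr'.le] at h
  rw [funext hG]
  refine (h r ⟨hr, by linarith⟩).mono_of_mem_nhdsWithin ?_
  rw [← Ici_inter_Iic]
  exact inter_mem self_mem_nhdsWithin (mem_nhdsWithin_of_mem_nhds (Iic_mem_nhds (by linarith)))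

/-- Two functions agreeing at `0` compare on `[0, ∞)` as their derivatives do. -/
theorem le_of_hasDerivAt_le_Ioi {u v u' v' : ℝ → ℝ} (hu : ContinuousOn u (Ici 0))
    (hv : ContinuousOn v (Ici 0)) (hu' : ∀ s, 0 < s → HasDerivAt u (u' s) s)
    (hv' : ∀ s, 0 < s → HasDerivAt v (v' s) s) (h : ∀ s, 0 < s → u' s ≤ v' s)
    (h₀ : u 0 = v 0) {r : ℝ} (hr : 0 ≤ r) : u r ≤ v r := by
  have hmono : MonotoneOn (v - u) (Ici 0) := by
    refine monotoneOn_of_hasDerivWithinAt_nonneg (f' := v' - u') (convex_Ici 0) (hv.sub hu) ?_ ?_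
    · intro s hs
      rw [interior_Ici] at hs
      exact ((hv' s hs).sub (hu' s hs)).hasDerivWithinAt
    · intro s hs
      rw [interior_Ici] at hs
      exact sub_nonneg.2 (h s hs)
  have := hmono self_mem_Ici (mem_Ici.2 hr) hr
  simp only [Pi.sub_apply, h₀] at this
  linarith

/-- The inverse of a strictly increasing bijection of `[0, ∞)` is continuous on `(0, ∞)`. -/
theorem continuousAt_inverse_of_strictMonoOn_Ici {G Ginv : ℝ → ℝ} (hmono : StrictMonoOn G (Ici 0))
    (hG₀ : G 0 = 0) (hGinv : ∀ r, 0 ≤ r → Ginv (G r) = r)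
    (hGinv' : ∀ τ, 0 ≤ τ → 0 ≤ Ginv τ ∧ G (Ginv τ) = τ) {τ : ℝ} (hτ : 0 < τ) :
    ContinuousAt Ginv τ := by
  have hpos : ∀ {r}, 0 < r → 0 < G r := fun {r} hr => by
    simpa [hG₀] using hmono self_mem_Ici (mem_Ici.2 hr.le) hr
  have hinv : StrictMonoOn Ginv (Ioi 0) := by
    intro a ha b hb hab
    obtain ⟨ha₀, ha'⟩ := hGinv' a (le_of_lt ha)
    obtain ⟨hb₀, hb'⟩ := hGinv' b (le_of_lt hb)
    rw [← hmono.lt_iff_lt ha₀ hb₀, ha', hb']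
    exact hab
  have hτ' : 0 < Ginv τ := by
    obtain ⟨h₀, h₁⟩ := hGinv' τ hτ.le
    refine h₀.lt_of_ne fun h => ?_
    rw [← h, hG₀] at h₁
    exact hτ.ne h₁
  refine hinv.continuousAt_of_image_mem_nhds (Ioi_mem_nhds hτ)
    (mem_of_superset (Ioi_mem_nhds hτ') ?_)
  exact fun r hr => ⟨G r, hpos hr, hGinv r (le_of_lt hr)⟩

/-- Logarithmic derivative of `(R(t)^p / τ(t))^{1/(p-1)}`. -/
theorem hasDerivAt_rpow_div_rpow {R τ : ℝ → ℝ} {R' τ' p q t : ℝ} (hR : HasDerivAt R R' t)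
    (hτ : HasDerivAt τ τ' t) (hR₀ : 0 < R t) (hτ₀ : 0 < τ t) :
    HasDerivAt (fun x => (R x ^ p / τ x) ^ q)
      (q * (R t ^ p / τ t) ^ q * (p * R' / R t - τ' / τ t)) t := by
  have hpos : 0 < R t ^ p / τ t := by positivity
  have hquot : HasDerivAt (fun x => R x ^ p / τ x)
      ((R' * p * R t ^ (p - 1) * τ t - R t ^ p * τ') / τ t ^ 2) t :=
    (hR.rpow_const (Or.inl hR₀.ne')).div hτ hτ₀.ne'
  convert hquot.rpow_const (p := q) (Or.inl hpos.ne') using 1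
  rw [Real.rpow_sub_one hpos.ne', Real.rpow_sub_one hR₀.ne']
  have := (Real.rpow_pos_of_pos hR₀ p).ne'
  field_simp


/-- With `E(τ) = G⁻¹(τ)^p/τ`, `Γ ≥ 1`, `t₀ > 1`, and
`τ(t) = Γ·log(t+t₀)`, for every `t ≥ 0` the function
`t ↦ E(τ(t))^{1/(p−1)}` is differentiable with the stated two-sided bound. -/
theorem E_time_derivative_bounds
    (α₁ α₂ : ℝ) (g g' : ℝ → ℝ)
    (hα₁ : 0 < α₁) (hα₁₂ : α₁ ≤ α₂)
    (hgc : ContinuousOn g (Set.Ici 0))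
    (hgd : ∀ s ∈ Set.Ioi (0:ℝ), HasDerivAt g (g' s) s)
    (hg'c : ContinuousOn g' (Set.Ioi 0))
    (hg0 : g 0 = 0)
    (hgpos : ∀ s, 0 < s → 0 < g s)
    (hlow : ∀ s, 0 < s → α₁ * g s / s ≤ g' s)
    (hupp : ∀ s, 0 < s → g' s ≤ α₂ * g s / s)
    (G Ginv : ℝ → ℝ) (hG : ∀ r, G r = ∫ s in (0:ℝ)..r, g s / s)
    (hGinv : ∀ r, 0 ≤ r → Ginv (G r) = r)
    (hGinv' : ∀ τ, 0 ≤ τ → 0 ≤ Ginv τ ∧ G (Ginv τ) = τ)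
    (p : ℝ) (hp : 1 < p) (hα₂p : α₂ < p)
    (E : ℝ → ℝ) (hE : ∀ τ, 0 < τ → E τ = Ginv τ ^ p / τ)
    (Γ t₀ : ℝ) (hΓ : 1 ≤ Γ) (ht₀ : 1 < t₀)
    (t : ℝ) (ht : 0 ≤ t) :
    ∃ d : ℝ,
      HasDerivAt (fun t' => E (Γ * Real.log (t' + t₀)) ^ (1/(p-1))) d t ∧
      (p - α₂) / (α₂ * (p - 1)) * (Γ / ((t + t₀) * (Γ * Real.log (t + t₀)))) *
          E (Γ * Real.log (t + t₀)) ^ (1/(p-1)) ≤ d ∧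
      d ≤ (p - α₁) / (α₁ * (p - 1)) * (Γ / ((t + t₀) * (Γ * Real.log (t + t₀)))) *
          E (Γ * Real.log (t + t₀)) ^ (1/(p-1)) := by
  have hf : ContinuousOn (fun s => g s / s) (Ioi 0) :=
    (hgc.mono Ioi_subset_Ici_self).div continuousOn_id fun s hs => ne_of_gt hs
  have hint := fun r (hr : 0 < r) => intervalIntegrable_of_leftInverse_primitive hG hGinv hr
  have hGd : ∀ r, 0 < r → HasDerivAt G (g r / r) r := fun r hr =>
    hasDerivAt_primitive_of_continuousOn_Ioi hG hf hr (hint r hr)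
  have hGc : ContinuousOn G (Ici 0) := continuousOn_primitive_Ici hG hint
  have hG₀ : G 0 = 0 := by rw [hG, intervalIntegral.integral_same]
  have hmono : StrictMonoOn G (Ici 0) := by
    refine strictMonoOn_of_deriv_pos (convex_Ici 0) hGc fun s hs => ?_
    rw [interior_Ici] at hs
    rw [(hGd s hs).deriv]
    exact div_pos (hgpos s hs) hs
  have hGlow : ∀ r, 0 ≤ r → α₁ * G r ≤ g r := fun r hr =>
    le_of_hasDerivAt_le_Ioi (continuousOn_const.mul hGc) hgc
      (fun s hs => (hGd s hs).const_mul α₁) hgd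
      (fun s hs => by simpa only [mul_div_assoc] using hlow s hs) (by simp [hG₀, hg0]) hr
  have hGupp : ∀ r, 0 ≤ r → g r ≤ α₂ * G r := fun r hr =>
    le_of_hasDerivAt_le_Ioi hgc (continuousOn_const.mul hGc) hgd
      (fun s hs => (hGd s hs).const_mul α₂)
      (fun s hs => by simpa only [mul_div_assoc] using hupp s hs) (by simp [hG₀, hg0]) hr
  have ht' : 1 < t + t₀ := by linarith
  have hΓ₀ : 0 < Γ := by linarith
  have hτd : HasDerivAt (fun x => Γ * Real.log (x + t₀)) (Γ / (t + t₀)) t := by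
    simpa [div_eq_mul_inv] using
      (((hasDerivAt_id t).add_const t₀).log (by simp; linarith)).const_mul Γ
  have hτ : 0 < Γ * Real.log (t + t₀) := mul_pos hΓ₀ (Real.log_pos ht')
  set τ := Γ * Real.log (t + t₀) with hτ_def
  obtain ⟨hR₀, hGR⟩ := hGinv' τ hτ.le
  have hR : 0 < Ginv τ := hR₀.lt_of_ne fun h => by
    rw [← h, hG₀] at hGR
    exact hτ.ne hGR
  have hgR := hgpos _ hR
  have hlowR := hGlow _ hR₀
  have huppR := hGupp _ hR₀
  rw [hGR] at hlowR huppR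
  have hinvd : HasDerivAt Ginv (g (Ginv τ) / Ginv τ)⁻¹ τ :=
    (hGd _ hR).of_local_left_inverse
      (continuousAt_inverse_of_strictMonoOn_Ici hmono hG₀ hGinv hGinv' hτ) (div_pos hgR hR).ne'
      (by filter_upwards [Ioi_mem_nhds hτ] with x hx using (hGinv' x (le_of_lt hx)).2)
  have hd := hasDerivAt_rpow_div_rpow (p := p) (q := 1 / (p - 1))
    (HasDerivAt.comp t hinvd hτd) hτd hR hτ
  have hE_eq : (fun x => E (Γ * Real.log (x + t₀)) ^ (1 / (p - 1))) =ᶠ[𝓝 t]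
      fun x => ((Ginv ∘ fun x => Γ * Real.log (x + t₀)) x ^ p / (Γ * Real.log (x + t₀))) ^
        (1 / (p - 1)) := by
    filter_upwards [hτd.continuousAt.eventually (Ioi_mem_nhds hτ)] with x hx
    rw [hE _ hx, Function.comp_apply]
  refine ⟨_, hd.congr_of_eventuallyEq hE_eq, ?_⟩
  simp only [Function.comp_apply, ← hτ_def]
  rw [← hE τ hτ]
  have hEpos : 0 < E τ := by rw [hE τ hτ]; positivity
  have hα₂ : 0 < α₂ := hα₁.trans_le hα₁₂
  have hp₁ : 0 < p - 1 := sub_pos.2 hp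
  have hp₀ : 0 < p := by linarith
  set c := 1 / (p - 1) * E τ ^ (1 / (p - 1)) * (Γ / (t + t₀)) with hc_def
  have hc : 0 ≤ c := by positivity
  have hderiv : 1 / (p - 1) * E τ ^ (1 / (p - 1)) *
      (p * ((g (Ginv τ) / Ginv τ)⁻¹ * (Γ / (t + t₀))) / Ginv τ - Γ / (t + t₀) / τ) =
      c * (p / g (Ginv τ) - 1 / τ) := by
    rw [hc_def]
    field_simp
  have hbound : ∀ α, 0 < α → (p - α) / (α * (p - 1)) * (Γ / ((t + t₀) * τ)) *
      E τ ^ (1 / (p - 1)) = c * (p / (α * τ) - 1 / τ) := by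
    intro α hα
    rw [hc_def]
    field_simp
  rw [hderiv, hbound α₁ hα₁, hbound α₂ hα₂]
  constructor <;> gcongr
end

section
/- Assume 1 < p < N, p + m − 3 > 0 and α₂ < p. Then the constants C* > 0, Γ ≥ 1, t₀ > 1, r₀ > 0 and ν₀ ∈ (0,1) can be chosen so that the function ũ is continuously differentiable in r = |x| (in particular across r = r₀) on the set where ũ > 0, and at every point (x,t) with t ≥ 0, r = |x| > 0, r ≠ r₀ and ũ(x,t) > 0 it satisfies the pointwise supersolution inequality ∂ₜũ ≥ ∂ᵣ( ũ^{m−1} |∂ᵣũ|^{p−2} ∂ᵣũ ) + ((N−1)/r + g'(r)) · ũ^{m−1} |∂ᵣũ|^{p−2} ∂ᵣũ. -/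
/-- The barrier function `ũ` of the paper, written radially:
`ũ(r,t) = C·(t+t₀)^{−1/(p+m−3)}·[E(τ)^{1/(p−1)} − J(r)^{1/(p−1)}]₊^{(p−1)/(p+m−3)}`
for `r ≥ r₀`, and with `J(r)^{1/(p−1)}` replaced by
`I(r) = ν₀·(r^p/G(r₀))^{1/(p−1)} + (1−ν₀)·J(r₀)^{1/(p−1)}` for `r < r₀`;
here `τ = Γ·log(t+t₀)`, `E(τ) = G⁻¹(τ)^p/τ` and `J(r) = r^p/G(r)`. -/
noncomputable def utilde (p m C Γ t₀ r₀ ν₀ : ℝ) (G Ginv : ℝ → ℝ) (r t : ℝ) : ℝ :=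
  C * (t + t₀) ^ (-(1/(p+m-3))) *
    (if r₀ ≤ r then
      max ((Ginv (Γ * Real.log (t + t₀)) ^ p / (Γ * Real.log (t + t₀))) ^ (1/(p-1))
            - (r ^ p / G r) ^ (1/(p-1))) 0
    else
      max ((Ginv (Γ * Real.log (t + t₀)) ^ p / (Γ * Real.log (t + t₀))) ^ (1/(p-1))
            - (ν₀ * (r ^ p / G r₀) ^ (1/(p-1)) + (1 - ν₀) * (r₀ ^ p / G r₀) ^ (1/(p-1)))) 0)
      ^ ((p-1)/(p+m-3))

open Set Filter Topology MeasureTheory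

/-- A positive function `g` whose logarithmic slope lies in `[α₁, α₂]`, together with a positive
primitive `G` of `g s / s`, whose logarithmic slope then lies in the same range. -/
structure GrowthPair (α₁ α₂ : ℝ) (g g' G : ℝ → ℝ) : Prop where
  g_pos : ∀ r, 0 < r → 0 < g r
  g_hasDerivAt : ∀ r, 0 < r → HasDerivAt g (g' r) r
  lower : ∀ r, 0 < r → α₁ * g r / r ≤ g' r
  upper : ∀ r, 0 < r → g' r ≤ α₂ * g r / r
  G_pos : ∀ r, 0 < r → 0 < G r
  G_hasDerivAt : ∀ r, 0 < r → HasDerivAt G (g r / r) r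
  lower_G : ∀ r, 0 < r → α₁ * G r ≤ g r
  upper_G : ∀ r, 0 < r → g r ≤ α₂ * G r

theorem growthPair_of_integral {α₁ α₂ : ℝ} {g g' G : ℝ → ℝ}
    (hα₁ : 0 < α₁) (hα₁₂ : α₁ ≤ α₂)
    (hgc : ContinuousOn g (Ici 0))
    (hgd : ∀ s ∈ Ioi (0:ℝ), HasDerivAt g (g' s) s)
    (hg0 : g 0 = 0)
    (hgpos : ∀ s, 0 < s → 0 < g s)
    (hlow : ∀ s, 0 < s → α₁ * g s / s ≤ g' s)
    (hupp : ∀ s, 0 < s → g' s ≤ α₂ * g s / s)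
    (hG : ∀ r, G r = ∫ s in (0:ℝ)..r, g s / s) : GrowthPair α₁ α₂ g g' G := by
  have hα₂ : 0 < α₂ := hα₁.trans_le hα₁₂
  have hcont : ContinuousOn (fun s => g s / s) (Ioi 0) :=
    (hgc.mono Ioi_subset_Ici_self).div continuousOn_id fun x hx => ne_of_gt hx
  have hg'nn : ∀ s, 0 < s → 0 ≤ g' s := fun s hs =>
    le_trans (by have := hgpos s hs; positivity) (hlow s hs)
  have hi' : ∀ r, 0 < r → IntegrableOn g' (Ioc 0 r) := fun r hr =>
    intervalIntegral.integrableOn_deriv_of_nonneg (hgc.mono Icc_subset_Ici_self)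
      (fun x hx => hgd x hx.1) (fun x hx => hg'nn x hx.1)
  have hi'' : ∀ r, 0 < r → IntervalIntegrable g' volume 0 r := fun r hr =>
    (intervalIntegrable_iff_integrableOn_Ioc_of_le hr.le).2 (hi' r hr)
  have hint : ∀ r, 0 < r → ∫ s in (0:ℝ)..r, g' s = g r := fun r hr => by
    rw [intervalIntegral.integral_eq_sub_of_hasDerivAt_of_le hr.le (hgc.mono Icc_subset_Ici_self)
      (fun x hx => hgd x hx.1) (hi'' r hr), hg0, sub_zero]
  have hi : ∀ r, 0 < r → IntervalIntegrable (fun s => g s / s) volume 0 r := fun r hr => by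
    rw [intervalIntegrable_iff_integrableOn_Ioc_of_le hr.le]
    refine Integrable.mono' ((hi' r hr).const_mul α₁⁻¹)
      ((hcont.mono fun x hx => hx.1).aestronglyMeasurable measurableSet_Ioc) ?_
    refine (ae_restrict_iff' measurableSet_Ioc).2 (Eventually.of_forall fun s hs => ?_)
    have h1 := hgpos s hs.1
    have h2 := hs.1
    rw [Real.norm_of_nonneg (by positivity), ← div_eq_inv_mul, le_div_iff₀ hα₁]
    calc g s / s * α₁ = α₁ * g s / s := by ring
      _ ≤ g' s := hlow s hs.1
  refine ⟨hgpos, hgd, hlow, hupp, ?_, ?_, ?_, ?_⟩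
  · intro r hr
    rw [hG]
    exact intervalIntegral.intervalIntegral_pos_of_pos_on (hi r hr)
      (fun x hx => div_pos (hgpos x hx.1) hx.1) hr
  · intro r hr
    rw [show G = fun r => ∫ s in (0:ℝ)..r, g s / s from funext hG]
    exact intervalIntegral.integral_hasDerivAt_right (hi r hr)
      (hcont.stronglyMeasurableAtFilter isOpen_Ioi r hr) (hcont.continuousAt (Ioi_mem_nhds hr))
  · intro r hr
    rw [hG, ← hint r hr, ← intervalIntegral.integral_const_mul]
    refine intervalIntegral.integral_mono_on_of_le_Ioo hr.le ((hi r hr).const_mul _) (hi'' r hr)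
      fun x hx => ?_
    rw [← mul_div_assoc]
    exact hlow x hx.1
  · intro r hr
    rw [hG, ← hint r hr, ← intervalIntegral.integral_const_mul]
    refine intervalIntegral.integral_mono_on_of_le_Ioo hr.le (hi'' r hr) ((hi r hr).const_mul _)
      fun x hx => ?_
    rw [← mul_div_assoc]
    exact hupp x hx.1

namespace GrowthPair

variable {α₁ α₂ : ℝ} {g g' G : ℝ → ℝ}

theorem continuousOn_G (h : GrowthPair α₁ α₂ g g' G) : ContinuousOn G (Ioi 0) :=
  fun r hr => (h.G_hasDerivAt r hr).continuousAt.continuousWithinAt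

theorem strictMonoOn_G (h : GrowthPair α₁ α₂ g g' G) : StrictMonoOn G (Ioi 0) := by
  refine strictMonoOn_of_deriv_pos (convex_Ioi 0) h.continuousOn_G fun x hx => ?_
  rw [interior_Ioi] at hx
  rw [(h.G_hasDerivAt x hx).deriv]
  exact div_pos (h.g_pos x hx) hx

theorem G_div_rpow_antitoneOn (h : GrowthPair α₁ α₂ g g' G) :
    AntitoneOn (fun r => G r * r ^ (-α₂)) (Ioi 0) := by
  have hd : ∀ r, 0 < r → HasDerivAt (fun r => G r * r ^ (-α₂))
      (g r / r * r ^ (-α₂) + G r * (-α₂ * r ^ (-α₂ - 1))) r := fun r hr =>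
    (h.G_hasDerivAt r hr).mul (Real.hasDerivAt_rpow_const (Or.inl hr.ne'))
  refine antitoneOn_of_deriv_nonpos (convex_Ioi 0)
    (fun r hr => (hd r hr).continuousAt.continuousWithinAt)
    (fun r hr => (hd r (interior_subset hr)).differentiableAt.differentiableWithinAt) fun r hr => ?_
  rw [interior_Ioi] at hr
  have hr' : 0 < r := hr
  rw [(hd r hr).deriv, Real.rpow_sub_one hr'.ne']
  have h1 := h.upper_G r hr
  have : g r / r * r ^ (-α₂) + G r * (-α₂ * (r ^ (-α₂) / r))
      = (g r - α₂ * G r) * (r ^ (-α₂) / r) := by ring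
  rw [this]
  exact mul_nonpos_of_nonpos_of_nonneg (by linarith) (by positivity)

theorem G_div_le (h : GrowthPair α₁ α₂ g g' G) {r R : ℝ} (hr : 0 < r) (hR : r ≤ R) :
    G R / G r ≤ (R / r) ^ α₂ := by
  have hR0 : 0 < R := hr.trans_le hR
  have h1 : G R * R ^ (-α₂) ≤ G r * r ^ (-α₂) := h.G_div_rpow_antitoneOn hr hR0 hR
  rw [Real.rpow_neg hr.le, Real.rpow_neg hR0.le, ← div_eq_mul_inv, ← div_eq_mul_inv,
    div_le_div_iff₀ (by positivity) (by positivity)] at h1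
  rw [Real.div_rpow hR0.le hr.le, div_le_div_iff₀ (h.G_pos r hr) (by positivity)]
  linarith

/-- The weight `(r^p / G r)^(1/(p-1))` is monotone when `α₂ < p`. -/
theorem weight_le (h : GrowthPair α₁ α₂ g g' G) {p r R : ℝ} (hp : 1 < p) (hα₂p : α₂ < p)
    (hr : 0 < r) (hR : r ≤ R) : (r ^ p / G r) ^ (1/(p-1)) ≤ (R ^ p / G R) ^ (1/(p-1)) := by
  have hR0 : 0 < R := hr.trans_le hR
  have h0 := h.G_pos r hr
  have h0' := h.G_pos R hR0
  have hp1 : 0 < p - 1 := by linarith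
  refine Real.rpow_le_rpow (by positivity) ?_ (by positivity)
  have h1 := (h.G_div_le hr hR).trans
    (Real.rpow_le_rpow_of_exponent_le ((one_le_div hr).2 hR) hα₂p.le)
  rw [Real.div_rpow hR0.le hr.le, div_le_div_iff₀ h0 (by positivity)] at h1
  rw [div_le_div_iff₀ h0 h0']
  linarith

/-- If the weights at `r ≤ R` are comparable, then so are the values of `G`. -/
theorem G_le_of_weight_le (h : GrowthPair α₁ α₂ g g' G) {p r R M : ℝ} (hα₂ : 0 < α₂) (hp : 1 < p)
    (hα₂p : α₂ < p) (hM : 0 < M) (hr : 0 < r) (hR : r ≤ R)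
    (hle : (R ^ p / G R) ^ (1/(p-1)) ≤ M * (r ^ p / G r) ^ (1/(p-1))) :
    G R ≤ (M ^ (p-1)) ^ (p/α₂-1)⁻¹ * G r := by
  have hR0 : 0 < R := hr.trans_le hR
  have h0 := h.G_pos r hr
  have h0' := h.G_pos R hR0
  have hp1 : 0 < p - 1 := by linarith
  have hexp : 0 < p / α₂ - 1 := by rw [sub_pos, one_lt_div hα₂]; exact hα₂p
  rw [← div_le_iff₀ h0]
  set X := G R / G r with hX
  have hXpos : 0 < X := by positivity
  have h2 : R ^ p / G R ≤ M ^ (p-1) * (r ^ p / G r) := by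
    have := Real.rpow_le_rpow (by positivity) hle hp1.le
    rwa [Real.mul_rpow hM.le (by positivity), ← Real.rpow_mul (by positivity),
      ← Real.rpow_mul (by positivity), one_div_mul_cancel hp1.ne', Real.rpow_one,
      Real.rpow_one] at this
  have h3 : (R / r) ^ p ≤ M ^ (p-1) * X := by
    rw [Real.div_rpow hR0.le hr.le, hX, div_le_iff₀ (by positivity)]
    rw [div_le_iff₀ h0'] at h2
    calc R ^ p ≤ M ^ (p-1) * (r ^ p / G r) * G R := h2
      _ = _ := by ring
  have h4 : X ^ (p/α₂) ≤ (R / r) ^ p := by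
    have := Real.rpow_le_rpow hXpos.le (h.G_div_le hr hR)
      (show 0 ≤ p / α₂ by positivity)
    rwa [← Real.rpow_mul (by positivity), mul_div_cancel₀ _ hα₂.ne'] at this
  have h5 : X ^ (p/α₂-1) ≤ M ^ (p-1) := by
    rw [Real.rpow_sub_one hXpos.ne', div_le_iff₀ hXpos]
    exact h4.trans h3
  calc X = (X ^ (p/α₂-1)) ^ (p/α₂-1)⁻¹ := by
        rw [← Real.rpow_mul hXpos.le, mul_inv_cancel₀ hexp.ne', Real.rpow_one]
    _ ≤ _ := Real.rpow_le_rpow (by positivity) h5 (by positivity)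

/-- The weight divided by `G` at `r` is absorbed by its value at `R ≥ r`, up to a small multiple of
the increment of the weight. -/
theorem exists_weight_div_le (h : GrowthPair α₁ α₂ g g' G) {p ε : ℝ} (hα₂ : 0 < α₂) (hp : 1 < p)
    (hα₂p : α₂ < p) (hε : 0 < ε) :
    ∃ K, 0 < K ∧ ∀ r R, 0 < r → r ≤ R →
      (r ^ p / G r) ^ (1/(p-1)) / G r ≤ K * ((R ^ p / G R) ^ (1/(p-1)) / G R)
        + ε * (((R ^ p / G R) ^ (1/(p-1)) - (r ^ p / G r) ^ (1/(p-1))) / G r) := by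
  have hM : 0 < 1 + 1 / ε := by positivity
  refine ⟨((1 + 1/ε) ^ (p-1)) ^ (p/α₂-1)⁻¹, by positivity, fun r R hr hR => ?_⟩
  have hR0 : 0 < R := hr.trans_le hR
  have h0 := h.G_pos r hr
  have h0' := h.G_pos R hR0
  have hmono := h.weight_le hp hα₂p hr hR
  have key := h.G_le_of_weight_le hα₂ hp hα₂p hM hr hR
  set j := (r ^ p / G r) ^ (1/(p-1))
  set e := (R ^ p / G R) ^ (1/(p-1))
  set K := ((1 + 1/ε) ^ (p-1)) ^ (p/α₂-1)⁻¹ with hK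
  have hK0 : 0 < K := by positivity
  have he : 0 ≤ e := by positivity
  rcases le_total j (ε * (e - j)) with hc | hc
  · have h1 : j / G r ≤ ε * ((e - j) / G r) := by
      rw [← mul_div_assoc]
      gcongr
    have h2 : 0 ≤ K * (e / G R) := by positivity
    linarith
  · have h1 : e ≤ (1 + 1/ε) * j := by
      have : (e - j) ≤ j / ε := by rw [le_div_iff₀ hε]; linarith
      calc e ≤ j + j / ε := by linarith
        _ = _ := by ring
    have h2 := key h1
    have h3 : j / G r ≤ K * (e / G R) := by
      rw [← mul_div_assoc, div_le_div_iff₀ h0 h0']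
      calc j * G R ≤ e * (K * G r) := by gcongr
        _ = _ := by ring
    have h4 : 0 ≤ ε * ((e - j) / G r) := by
      have : 0 ≤ e - j := by linarith
      positivity
    linarith

theorem hasDerivAt_inverse (h : GrowthPair α₁ α₂ g g' G) {Ginv : ℝ → ℝ} (hG0 : G 0 = 0)
    (hGinv : ∀ r, 0 ≤ r → Ginv (G r) = r)
    (hGinv' : ∀ τ, 0 ≤ τ → 0 ≤ Ginv τ ∧ G (Ginv τ) = τ) {τ : ℝ} (hτ : 0 < τ) :
    0 < Ginv τ ∧ HasDerivAt Ginv (Ginv τ / g (Ginv τ)) τ := by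
  have hpos : ∀ τ, 0 < τ → 0 < Ginv τ := fun τ hτ => by
    refine lt_of_le_of_ne (hGinv' τ hτ.le).1 fun h0 => ?_
    have := (hGinv' τ hτ.le).2
    rw [← h0, hG0] at this
    exact hτ.ne this
  have hmono : StrictMonoOn Ginv (Ioi 0) := fun x hx y hy hxy => by
    by_contra! hc
    have := h.strictMonoOn_G.monotoneOn (hpos y hy) (hpos x hx) hc
    rw [(hGinv' x (le_of_lt hx)).2, (hGinv' y (le_of_lt hy)).2] at this
    exact absurd hxy this.not_gt
  have himg : Ioi 0 ⊆ Ginv '' Ioi 0 := fun r hr =>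
    ⟨G r, h.G_pos r hr, hGinv r (le_of_lt hr)⟩
  have hcont : ContinuousAt Ginv τ :=
    hmono.continuousAt_of_image_mem_nhds (Ioi_mem_nhds hτ)
      (mem_of_superset (Ioi_mem_nhds (hpos τ hτ)) himg)
  refine ⟨hpos τ hτ, ?_⟩
  have hR := hpos τ hτ
  have := HasDerivAt.of_local_left_inverse hcont (h.G_hasDerivAt _ hR)
    (div_pos (h.g_pos _ hR) hR).ne'
    ((eventually_gt_nhds hτ).mono fun y hy => (hGinv' y (le_of_lt hy)).2)
  rwa [inv_div] at this

end GrowthPair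

theorem hasDerivAt_weight {p r H' : ℝ} {H : ℝ → ℝ} (hr : 0 < r) (hH : 0 < H r)
    (hd : HasDerivAt H H' r) :
    HasDerivAt (fun r => (r ^ p / H r) ^ (1/(p-1)))
      ((r ^ p / H r) ^ (1/(p-1)) * ((p - r * H' / H r) / (p - 1)) / r) r := by
  have h1 : HasDerivAt (fun r => r ^ p) (p * r ^ (p-1)) r :=
    Real.hasDerivAt_rpow_const (Or.inl hr.ne')
  have h2 := (h1.div hd hH.ne').rpow_const (p := 1/(p-1))
    (Or.inl (by simp only [Pi.div_apply]; positivity))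
  refine h2.congr_deriv ?_
  have h3 : (r ^ p / H r) ≠ 0 := by positivity
  simp only [Pi.div_apply]
  rw [Real.rpow_sub_one h3, Real.rpow_sub_one hr.ne']
  have : r ^ p ≠ 0 := by positivity
  field_simp

theorem weight_mul_div_rpow {p r c X : ℝ} (hp : 1 < p) (hr : 0 < r) (hX : 0 < X) (hc : 0 ≤ c) :
    ((r ^ p / X) ^ (1/(p-1)) * c / r) ^ (p-1) = c ^ (p-1) * (r / X) := by
  have hp1 : p - 1 ≠ 0 := by linarith
  rw [Real.div_rpow (by positivity) hr.le, Real.mul_rpow (by positivity) hc,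
    ← Real.rpow_mul (by positivity), one_div_mul_cancel hp1, Real.rpow_one,
    Real.rpow_sub_one hr.ne']
  have : r ^ p ≠ 0 := by positivity
  field_simp

theorem weight_mul_div_rpow' {p r c X : ℝ} (hp : 1 < p) (hr : 0 < r) (hX : 0 < X) (hc : 0 < c) :
    ((r ^ p / X) ^ (1/(p-1)) * c / r) ^ p = c ^ p * ((r ^ p / X) ^ (1/(p-1)) / X) := by
  have h1 : 0 < (r ^ p / X) ^ (1/(p-1)) * c / r := by positivity
  have h2 := weight_mul_div_rpow hp hr hX hc.le
  rw [Real.rpow_sub_one h1.ne', Real.rpow_sub_one hc.ne', div_eq_iff h1.ne'] at h2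
  rw [h2]
  field_simp

/-- The flux `u^(m-1) |u_r|^(p-2) u_r` of `u = c F^q` with `q = (p-1)/(p+m-3)`. -/
theorem flux_eq {p m c F d : ℝ} (hp : 1 < p) (hm : 0 < p + m - 3) (hc : 0 < c) (hF : 0 < F)
    (hd : 0 < d) :
    (c * F ^ ((p-1)/(p+m-3))) ^ (m-1) *
      |-(c * (((p-1)/(p+m-3)) * F ^ ((p-1)/(p+m-3) - 1) * d))| ^ (p-2) *
        -(c * (((p-1)/(p+m-3)) * F ^ ((p-1)/(p+m-3) - 1) * d)) =
      -(c ^ (p+m-3) * c * ((p-1)/(p+m-3)) ^ (p-1) * (F ^ ((p-1)/(p+m-3)) * d ^ (p-1))) := by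
  set q := (p-1)/(p+m-3) with hq
  have hq0 : 0 < q := div_pos (by linarith) hm
  have hqe : q * (m-1) + (q-1) * (p-1) = q := by
    have : q * (p+m-3) = p-1 := div_mul_cancel₀ _ hm.ne'
    linear_combination this
  have hX : 0 < c * (q * F ^ (q-1) * d) := by positivity
  rw [abs_neg, abs_of_pos hX, mul_neg, mul_assoc, ← Real.rpow_add_one hX.ne',
    show p - 2 + 1 = p - 1 by ring, Real.mul_rpow hc.le (by positivity),
    Real.mul_rpow hc.le (by positivity), Real.mul_rpow (by positivity) hd.le,
    Real.mul_rpow hq0.le (by positivity), ← Real.rpow_mul hF.le, ← Real.rpow_mul hF.le]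
  have h1 : c ^ (p+m-3) * c = c ^ (m-1) * c ^ (p-1) := by
    rw [← Real.rpow_add_one hc.ne', ← Real.rpow_add hc]
    congr 1; ring
  have h2 : F ^ q = F ^ (q*(m-1)) * F ^ ((q-1)*(p-1)) := by
    rw [← Real.rpow_add hF, hqe]
  rw [h1, h2]
  ring

/-- Reduction of the supersolution inequality for
`u(r,t) = C (t+t₀)^(-1/(p+m-3)) [e(t) - j(r)]₊^((p-1)/(p+m-3))` to an inequality for `e` and `j`. -/
theorem supersolution_of_profile {p m C t₀ r t L e' Ψ' : ℝ} {U : ℝ → ℝ → ℝ} {e j d : ℝ → ℝ}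
    (hp : 1 < p) (hm : 0 < p + m - 3) (hC : 0 < C) (hS : 0 < t + t₀)
    (hU : ∀ᶠ r' in 𝓝 r, ∀ t, U r' t =
      C * (t + t₀) ^ (-(1/(p+m-3))) * (max (e t - j r') 0) ^ ((p-1)/(p+m-3)))
    (hj : ∀ᶠ r' in 𝓝 r, HasDerivAt j (d r') r')
    (hd : ∀ᶠ r' in 𝓝 r, 0 < d r')
    (hΨ : HasDerivAt (fun r => d r ^ (p-1)) Ψ' r)
    (he : HasDerivAt e e' t) (hF : 0 < e t - j r)
    (hineq : C ^ (p+m-3) * ((p-1)/(p+m-3)) ^ (p-1) *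
        ((p-1)/(p+m-3) * d r ^ p - (e t - j r) * (Ψ' + L * d r ^ (p-1))) ≤
      (p-1)/(p+m-3) * ((t + t₀) * e') - 1/(p+m-3) * (e t - j r)) :
    ∃ ut w : ℝ, HasDerivAt (fun t' => U r t') ut t ∧
      HasDerivAt (fun r' => U r' t ^ (m-1) * |deriv (fun r'' => U r'' t) r'| ^ (p-2) *
        deriv (fun r'' => U r'' t) r') w r ∧
      ut ≥ w + L * (U r t ^ (m-1) * |deriv (fun r'' => U r'' t) r| ^ (p-2) *
        deriv (fun r'' => U r'' t) r) := by
  set k := 1/(p+m-3) with hk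
  set q := (p-1)/(p+m-3) with hq
  have hq0 : 0 < q := div_pos (by linarith) hm
  set S := t + t₀ with hSdef
  set c := C * S ^ (-k) with hcdef
  have hc : 0 < c := by positivity
  have hcpow : c ^ (p+m-3) = C ^ (p+m-3) * S⁻¹ := by
    rw [hcdef, Real.mul_rpow hC.le (by positivity), ← Real.rpow_mul hS.le, hk, neg_mul,
      one_div_mul_cancel hm.ne', Real.rpow_neg_one]
  set B := C ^ (p+m-3) * q ^ (p-1) with hB
  have hFr : ∀ᶠ r' in 𝓝 r, 0 < e t - j r' :=
    (continuousAt_const.sub hj.self_of_nhds.continuousAt).eventually (lt_mem_nhds hF)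
  have hUr : ∀ᶠ r' in 𝓝 r, U r' t = c * (e t - j r') ^ q := by
    filter_upwards [hU, hFr] with r' h1 h2
    rw [h1, max_eq_left h2.le]
  have hder : ∀ᶠ r' in 𝓝 r, deriv (fun r'' => U r'' t) r' =
      -(c * (q * (e t - j r') ^ (q-1) * d r')) := by
    filter_upwards [hUr.eventually_nhds, hFr, hj] with r' h1 h2 h3
    have h4 : (fun r'' => U r'' t) =ᶠ[𝓝 r'] fun r'' => c * (e t - j r'') ^ q := h1
    rw [h4.deriv_eq, (((h3.const_sub (e t)).rpow_const (Or.inl h2.ne')).const_mul c).deriv]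
    ring
  have hflux : (fun r' => U r' t ^ (m-1) * |deriv (fun r'' => U r'' t) r'| ^ (p-2) *
      deriv (fun r'' => U r'' t) r') =ᶠ[𝓝 r]
      fun r' => -(c ^ (p+m-3) * c * q ^ (p-1) * ((e t - j r') ^ q * d r' ^ (p-1))) := by
    filter_upwards [hUr, hFr, hder, hd] with r' h1 h2 h3 h4
    rw [h1, h3]
    exact flux_eq hp hm hc h2 h4
  have hUt : (fun t' => U r t') =ᶠ[𝓝 t] fun t' => C * (t' + t₀) ^ (-k) * (e t' - j r) ^ q := by
    have : ∀ᶠ t' in 𝓝 t, 0 < e t' - j r :=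
      (he.continuousAt.sub continuousAt_const).eventually (lt_mem_nhds hF)
    filter_upwards [this] with t' h1
    rw [hU.self_of_nhds, max_eq_left h1.le]
  have hut := (((((hasDerivAt_id t).add_const t₀).rpow_const (p := -k) (Or.inl hS.ne')).const_mul
    C).mul ((he.sub_const (j r)).rpow_const (p := q) (Or.inl hF.ne'))).congr_of_eventuallyEq hUt
  have hw := ((((hj.self_of_nhds.const_sub (e t)).rpow_const (p := q) (Or.inl hF.ne')).mul
    hΨ).const_mul (c ^ (p+m-3) * c * q ^ (p-1))).neg.congr_of_eventuallyEq hflux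
  refine ⟨_, _, hut, hw, ?_⟩
  have hflux_r := hflux.self_of_nhds
  beta_reduce at hflux_r
  rw [hflux_r]
  have hd0 := hd.self_of_nhds
  simp only [id]
  rw [← hSdef, Real.rpow_sub_one hS.ne', hcpow, Real.rpow_sub_one hF.ne', ge_iff_le, ← sub_nonneg]
  have hdp : d r ^ p = d r * d r ^ (p-1) := by
    rw [Real.rpow_sub_one hd0.ne']; field_simp
  rw [hdp] at hineq
  set F := e t - j r
  have hpos : 0 ≤ c * S⁻¹ * (F ^ q / F) := by positivity
  have := mul_nonneg hpos (sub_nonneg.2 hineq)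
  refine this.trans_eq ?_
  rw [hB, hcdef]
  field_simp
  ring

/-- Gluing two `C¹` functions with matching values and derivatives. -/
theorem contDiffOn_one_ite {a : ℝ} {f₁ f₂ d₁ d₂ : ℝ → ℝ} (ha : 0 < a)
    (h₁ : ∀ r, 0 < r → HasDerivAt f₁ (d₁ r) r) (h₂ : ∀ r, 0 < r → HasDerivAt f₂ (d₂ r) r)
    (c₁ : ContinuousOn d₁ (Ioi 0)) (c₂ : ContinuousOn d₂ (Ioi 0))
    (hf : f₁ a = f₂ a) (hd : d₁ a = d₂ a) :
    ContDiffOn ℝ 1 (fun r => if a ≤ r then f₁ r else f₂ r) (Ioi 0) := by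
  have hder : ∀ r, 0 < r → HasDerivAt (fun r => if a ≤ r then f₁ r else f₂ r)
      (d₁ (max r a) + d₂ (min r a) - d₁ a) r := by
    intro r hr
    rcases lt_trichotomy r a with h | h | h
    · rw [max_eq_right h.le, min_eq_left h.le, add_sub_cancel_left]
      refine (h₂ r hr).congr_of_eventuallyEq ?_
      filter_upwards [eventually_lt_nhds h] with x hx
      exact if_neg hx.not_ge
    · subst h
      rw [max_self, min_self, add_sub_cancel_left, ← hasDerivWithinAt_univ, ← Iic_union_Ici (a := r)]
      refine HasDerivWithinAt.union ?_ ?_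
      · refine (h₂ r hr).hasDerivWithinAt.congr_of_mem (fun x hx => ?_) self_mem_Iic
        rcases (show x ≤ r from hx).lt_or_eq with h | h
        · exact if_neg h.not_ge
        · rw [h, if_pos le_rfl, hf]
      · rw [← hd]
        exact (h₁ r hr).hasDerivWithinAt.congr_of_mem (fun x hx => if_pos hx) self_mem_Ici
    · rw [max_eq_left h.le, min_eq_right h.le, ← hd, add_sub_cancel_right]
      refine (h₁ r hr).congr_of_eventuallyEq ?_
      filter_upwards [eventually_gt_nhds h] with x hx
      exact if_pos hx.le
  rw [show (1 : WithTop ℕ∞) = 0 + 1 by simp, contDiffOn_succ_iff_deriv_of_isOpen isOpen_Ioi]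
  refine ⟨fun r hr => (hder r hr).differentiableAt.differentiableWithinAt, by simp, ?_⟩
  rw [contDiffOn_zero]
  refine ContinuousOn.congr (f := fun r => d₁ (max r a) + d₂ (min r a) - d₁ a) ?_
    fun r hr => (hder r hr).deriv
  refine ((c₁.comp (by fun_prop) fun r hr => ?_).add
    (c₂.comp (by fun_prop) fun r hr => ?_)).sub continuousOn_const
  · exact lt_max_of_lt_right ha
  · exact lt_min hr ha

namespace GrowthPair

variable {α₁ α₂ : ℝ} {g g' G : ℝ → ℝ}

theorem hasDerivAt_outer (h : GrowthPair α₁ α₂ g g' G) {p r : ℝ} (hr : 0 < r) :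
    HasDerivAt (fun r => (r ^ p / G r) ^ (1/(p-1)))
      ((r ^ p / G r) ^ (1/(p-1)) * ((p - g r / G r) / (p - 1)) / r) r := by
  have := hasDerivAt_weight (p := p) hr (h.G_pos r hr) (h.G_hasDerivAt r hr)
  rwa [mul_div_cancel₀ _ hr.ne'] at this

theorem continuousOn_outer_deriv (h : GrowthPair α₁ α₂ g g' G) {p : ℝ} :
    ContinuousOn (fun r => (r ^ p / G r) ^ (1/(p-1)) * ((p - g r / G r) / (p - 1)) / r)
      (Ioi 0) := by
  have hg : ContinuousOn g (Ioi 0) :=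
    fun r hr => (h.g_hasDerivAt r hr).continuousAt.continuousWithinAt
  refine ContinuousOn.div (ContinuousOn.mul
    (fun r hr => (h.hasDerivAt_outer hr).continuousAt.continuousWithinAt) ?_) continuousOn_id
    fun r hr => ne_of_gt hr
  exact (continuousOn_const.sub (hg.div h.continuousOn_G fun r hr =>
    (h.G_pos r hr).ne')).div_const _

theorem slope_mem (h : GrowthPair α₁ α₂ g g' G) {r : ℝ} (hr : 0 < r) :
    α₁ ≤ g r / G r ∧ g r / G r ≤ α₂ :=
  ⟨(le_div_iff₀ (h.G_pos r hr)).2 (h.lower_G r hr), (div_le_iff₀ (h.G_pos r hr)).2 (h.upper_G r hr)⟩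

/-- The divergence of the flux of the outer profile is bounded below where `g` is large. -/
theorem outer_divergence (h : GrowthPair α₁ α₂ g g' G) {n p r : ℝ} (hα₁ : 0 < α₁) (hp : 1 < p)
    (hα₂p : α₂ < p) (hn : 0 ≤ n) (hr : 0 < r)
    (hg : 2 * (α₂ + (p-1) * α₂ ^ 2 / (p-α₂)) ≤ α₁ * g r) :
    ∃ Ψ' : ℝ, HasDerivAt (fun r =>
        ((r ^ p / G r) ^ (1/(p-1)) * ((p - g r / G r) / (p - 1)) / r) ^ (p-1)) Ψ' r ∧
      α₁ ^ 2 / 2 * ((p-α₂)/(p-1)) ^ (p-1) ≤ Ψ' + (n / r + g' r) *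
        ((r ^ p / G r) ^ (1/(p-1)) * ((p - g r / G r) / (p - 1)) / r) ^ (p-1) := by
  have hp1 : 0 < p - 1 := by linarith
  have hslope : ∀ s, 0 < s → (p-α₂)/(p-1) ≤ (p - g s / G s) / (p - 1) := fun s hs => by
    have := (h.slope_mem hs).2
    gcongr
  have hc0 : 0 < (p-α₂)/(p-1) := div_pos (by linarith) hp1
  have heq : ∀ s, 0 < s →
      ((s ^ p / G s) ^ (1/(p-1)) * ((p - g s / G s) / (p - 1)) / s) ^ (p-1) =
        ((p - g s / G s) / (p - 1)) ^ (p-1) * (s / G s) := fun s hs =>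
    weight_mul_div_rpow hp hs (h.G_pos s hs) (hc0.le.trans (hslope s hs))
  have hG0 := h.G_pos r hr
  have hg0 := h.g_pos r hr
  have hcr := hc0.trans_le (hslope r hr)
  have hder := (((((h.g_hasDerivAt r hr).div (h.G_hasDerivAt r hr) hG0.ne').const_sub p).div_const
    (p-1)).rpow_const (p := p-1) (Or.inl hcr.ne')).mul
    ((hasDerivAt_id r).div (h.G_hasDerivAt r hr) hG0.ne')
  refine ⟨_, hder.congr_of_eventuallyEq ?_, ?_⟩
  · filter_upwards [eventually_gt_nhds hr] with s hs
    rw [heq s hs]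
    simp
  · rw [heq r hr]
    have hs1 := (h.slope_mem hr).1
    have hs2 := (h.slope_mem hr).2
    have hmono : ((p-α₂)/(p-1)) ^ (p-1) ≤ ((p - g r / G r) / (p - 1)) ^ (p-1) :=
      Real.rpow_le_rpow hc0.le (hslope r hr) hp1.le
    simp only [Pi.div_apply, id]
    rw [Real.rpow_sub_one hcr.ne' (p-1)]
    set s := r * g' r / g r with hs
    have hgs : g' r = s * g r / r := by rw [hs]; field_simp
    have hs_lower : α₁ ≤ s := by
      rw [hs, le_div_iff₀ hg0]
      have := h.lower r hr
      rw [div_le_iff₀ hr] at this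
      linarith
    have hs_upper : s ≤ α₂ := by
      rw [hs, div_le_iff₀ hg0]
      have := h.upper r hr
      rw [le_div_iff₀ hr] at this
      linarith
    set H := g r / G r with hH
    have hgH : g r = H * G r := by rw [hH]; field_simp
    set P := ((p - H) / (p - 1)) ^ (p-1) with hP
    have hP0 : 0 < P := by positivity
    have hpH : 0 < p - H := by linarith
    have hH0 : 0 < H := by linarith
    have hexpr : (-((g' r * G r - g r * (g r / r)) / G r ^ 2) / (p-1)) * (p-1) *
          (P / ((p - H) / (p-1))) * (r / G r) + P * ((1 * G r - r * (g r / r)) / G r ^ 2) +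
          (n / r + g' r) * (P * (r / G r)) =
        P / G r * (1 + n - H - (p-1) * (H * (s - H)) / (p - H) + s * g r) := by
      rw [hgs, hgH]
      field_simp
      ring
    rw [hexpr]
    have hb1 : H * (s - H) ≤ α₂ ^ 2 := by nlinarith
    have hb2 : (p-1) * (H * (s - H)) / (p - H) ≤ (p-1) * α₂ ^ 2 / (p-α₂) := by
      have hx : 0 < p - α₂ := by linarith
      gcongr
    have hb3 : α₁ * g r ≤ s * g r := by gcongr
    have hb4 : α₁ * g r / 2 ≤ 1 + n - H - (p-1) * (H * (s - H)) / (p - H) + s * g r := by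
      linarith
    calc α₁ ^ 2 / 2 * ((p-α₂)/(p-1)) ^ (p-1) ≤ α₁ * H / 2 * P := by
          have : α₁ ^ 2 ≤ α₁ * H := by nlinarith
          gcongr
      _ = P / G r * (α₁ * g r / 2) := by rw [hgH]; field_simp
      _ ≤ _ := by gcongr

theorem outer_gradient (h : GrowthPair α₁ α₂ g g' G) {p r : ℝ} (hα₁ : 0 < α₁) (hp : 1 < p)
    (hα₂p : α₂ < p) (hr : 0 < r) :
    ((r ^ p / G r) ^ (1/(p-1)) * ((p - g r / G r) / (p - 1)) / r) ^ p ≤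
      (p/(p-1)) ^ p * ((r ^ p / G r) ^ (1/(p-1)) / G r) := by
  have hp1 : 0 < p - 1 := by linarith
  have hs := h.slope_mem hr
  have hG0 := h.G_pos r hr
  have hpos : 0 < (p - g r / G r) / (p - 1) := div_pos (by linarith) hp1
  rw [weight_mul_div_rpow' hp hr hG0 hpos]
  have : (p - g r / G r) / (p - 1) ≤ p / (p-1) := by
    gcongr
    linarith
  gcongr

/-- The time derivative of the height of the barrier and a lower bound for it. -/
theorem hasDerivAt_height (h : GrowthPair α₁ α₂ g g' G) {Ginv : ℝ → ℝ} {p Γ t t₀ : ℝ}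
    (hα₂ : 0 < α₂) (hp : 1 < p) (hα₂p : α₂ < p) (hG0 : G 0 = 0)
    (hGinv : ∀ r, 0 ≤ r → Ginv (G r) = r)
    (hGinv' : ∀ τ, 0 ≤ τ → 0 ≤ Ginv τ ∧ G (Ginv τ) = τ) (hΓ : 0 < Γ) (ht : 1 < t + t₀) :
    ∃ e' : ℝ, HasDerivAt (fun t' => (Ginv (Γ * Real.log (t' + t₀)) ^ p /
        (Γ * Real.log (t' + t₀))) ^ (1/(p-1))) e' t ∧
      Γ * ((p-α₂)/((p-1)*α₂)) * ((Ginv (Γ * Real.log (t + t₀)) ^ p /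
        (Γ * Real.log (t + t₀))) ^ (1/(p-1)) / (Γ * Real.log (t + t₀))) ≤ (t + t₀) * e' := by
  have hp1 : 0 < p - 1 := by linarith
  have hS : 0 < t + t₀ := by linarith
  have hτ : 0 < Γ * Real.log (t + t₀) := mul_pos hΓ (Real.log_pos ht)
  have hτd : HasDerivAt (fun t' => Γ * Real.log (t' + t₀)) (Γ * (1 / (t + t₀))) t :=
    (((hasDerivAt_id t).add_const t₀).log hS.ne').const_mul Γ
  obtain ⟨hR, hRd⟩ := h.hasDerivAt_inverse hG0 hGinv hGinv' hτ
  have hGR := (hGinv' _ hτ.le).2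
  have hcomp := ((h.hasDerivAt_outer (p := p) hR).comp _ hRd).comp t hτd
  refine ⟨_, hcomp.congr_of_eventuallyEq ?_, ?_⟩
  · filter_upwards [hτd.continuousAt.eventually (lt_mem_nhds hτ)] with t' ht'
    simp only [Function.comp_apply]
    rw [(hGinv' _ (le_of_lt ht')).2]
  · have hs := h.slope_mem hR
    have hgR := h.g_pos _ hR
    have hug := h.upper_G _ hR
    rw [hGR] at hs hug ⊢
    set τ := Γ * Real.log (t + t₀)
    set R := Ginv τ
    set e := (R ^ p / τ) ^ (1/(p-1))
    have he : 0 < e := by positivity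
    have hx : 0 < p - α₂ := by linarith
    calc Γ * ((p-α₂)/((p-1)*α₂)) * (e / τ) = Γ * e * ((p-α₂)/(p-1)) / (α₂ * τ) := by
          field_simp
      _ ≤ Γ * e * ((p - g R / τ)/(p-1)) / g R := by
          have : 0 < p - g R / τ := by linarith
          gcongr
          exact hs.2
      _ = _ := by field_simp

end GrowthPair

theorem utilde_eq (p m C Γ t₀ r₀ ν₀ : ℝ) (G Ginv : ℝ → ℝ) (r t : ℝ) :
    utilde p m C Γ t₀ r₀ ν₀ G Ginv r t = C * (t + t₀) ^ (-(1/(p+m-3))) *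
      (max ((Ginv (Γ * Real.log (t + t₀)) ^ p / (Γ * Real.log (t + t₀))) ^ (1/(p-1)) -
        (if r₀ ≤ r then (r ^ p / G r) ^ (1/(p-1)) else
          ν₀ * (r ^ p / G r₀) ^ (1/(p-1)) + (1 - ν₀) * (r₀ ^ p / G r₀) ^ (1/(p-1)))) 0)
        ^ ((p-1)/(p+m-3)) := by
  unfold utilde
  split_ifs <;> rfl

theorem pos_of_utilde_pos {p m C Γ t₀ r₀ ν₀ : ℝ} {G Ginv : ℝ → ℝ} {r t : ℝ} (hp : 1 < p)
    (hm : 0 < p + m - 3) (h : 0 < utilde p m C Γ t₀ r₀ ν₀ G Ginv r t) :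
    0 < (Ginv (Γ * Real.log (t + t₀)) ^ p / (Γ * Real.log (t + t₀))) ^ (1/(p-1)) -
        (if r₀ ≤ r then (r ^ p / G r) ^ (1/(p-1)) else
          ν₀ * (r ^ p / G r₀) ^ (1/(p-1)) + (1 - ν₀) * (r₀ ^ p / G r₀) ^ (1/(p-1))) := by
  by_contra! hc
  rw [utilde_eq, max_eq_right hc, Real.zero_rpow (div_pos (by linarith) hm).ne', mul_zero] at h
  exact h.false

theorem hasDerivAt_inner {p r ν X b : ℝ} (hr : 0 < r) (hX : 0 < X) :
    HasDerivAt (fun r => ν * (r ^ p / X) ^ (1/(p-1)) + b)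
      ((r ^ p / X) ^ (1/(p-1)) * (ν * (p / (p - 1))) / r) r := by
  have := ((hasDerivAt_weight (p := p) hr hX (hasDerivAt_const r X)).const_mul ν).add_const b
  refine this.congr_deriv ?_
  rw [mul_zero, zero_div, sub_zero]
  ring

theorem continuousOn_inner_deriv {p ν X : ℝ} (hX : 0 < X) :
    ContinuousOn (fun r => (r ^ p / X) ^ (1/(p-1)) * (ν * (p / (p - 1))) / r) (Ioi 0) := by
  refine ContinuousOn.div (ContinuousOn.mul (fun r hr => ?_) continuousOn_const) continuousOn_id
    fun r hr => ne_of_gt hr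
  exact (hasDerivAt_weight hr hX (hasDerivAt_const r X)).continuousAt.continuousWithinAt

theorem inner_divergence {p r c X L : ℝ} (hp : 1 < p) (hr : 0 < r) (hX : 0 < X) (hc : 0 ≤ c)
    (hL : 0 ≤ L) :
    HasDerivAt (fun r => ((r ^ p / X) ^ (1/(p-1)) * c / r) ^ (p-1)) (c ^ (p-1) / X) r ∧
      c ^ (p-1) / X ≤ c ^ (p-1) / X + L * ((r ^ p / X) ^ (1/(p-1)) * c / r) ^ (p-1) := by
  constructor
  · have := ((hasDerivAt_id r).div_const X).const_mul (c ^ (p-1))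
    rw [mul_one_div] at this
    refine this.congr_of_eventuallyEq ?_
    filter_upwards [eventually_gt_nhds hr] with s hs
    exact weight_mul_div_rpow hp hs hX hc
  · have : 0 ≤ L * ((r ^ p / X) ^ (1/(p-1)) * c / r) ^ (p-1) := by positivity
    linarith

theorem inner_gradient {p r r₀ ν X : ℝ} (hp : 1 < p) (hr : 0 < r) (hr₀ : r ≤ r₀) (hX : 0 < X)
    (hν : 0 < ν) (hν1 : ν ≤ 1) :
    ((r ^ p / X) ^ (1/(p-1)) * (ν * (p / (p - 1))) / r) ^ p ≤
      (p/(p-1)) ^ p * ((r₀ ^ p / X) ^ (1/(p-1)) / X) := by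
  have hp1 : 0 < p - 1 := by linarith
  rw [weight_mul_div_rpow' hp hr hX (by positivity)]
  have : ν * (p / (p-1)) ≤ p / (p-1) := mul_le_of_le_one_left (by positivity) hν1
  gcongr

theorem half_mul_increment_le {a c e j j₀ ν X : ℝ} (hX : 0 < X) (hc : 0 ≤ c) (hac : a ≤ c)
    (hν : 0 ≤ ν) (hj : j ≤ j₀) (he : j₀ ≤ e) :
    a / 2 * ((e - j₀) / X) ≤ c / X / 2 * (e - (ν * j + (1 - ν) * j₀)) := by
  have h0 : 0 ≤ e - j₀ := by linarith
  have h1 : e - j₀ ≤ e - (ν * j + (1 - ν) * j₀) := by nlinarith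
  calc a / 2 * ((e - j₀) / X) ≤ c / 2 * ((e - j₀) / X) := by gcongr
    _ = c / X / 2 * (e - j₀) := by ring
    _ ≤ _ := by gcongr

/-- The zeroth order term absorbs the gradient term in the reduced inequality. -/
theorem reduced_inequality {B q k c c₂ F T D W K X Y E : ℝ} (hB : 0 ≤ B) (hq : 0 ≤ q)
    (hc₂ : 0 ≤ c₂) (hF : 0 ≤ F) (hT : c ≤ T) (hBc : 2 * k ≤ B * c) (hD : D ≤ c₂ * W)
    (hW : W ≤ K * X + Y) (hY : q * c₂ * Y ≤ c / 2 * F) (hX : B * c₂ * K * X ≤ E) :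
    B * (q * D - F * T) ≤ q * E - k * F := by
  have h1 : B * q * D ≤ B * q * (c₂ * (K * X + Y)) := by gcongr; exact hD.trans (by gcongr)
  have h2 : B * F * c ≤ B * F * T := by gcongr
  have h3 : B * (q * c₂ * Y) ≤ B * (c / 2 * F) := by gcongr
  have h4 : q * (B * c₂ * K * X) ≤ q * E := by gcongr
  have h5 : 2 * k * F ≤ B * c * F := by gcongr
  linarith

/-- for `1 < p < N`, `p + m − 3 > 0`, `α₂ < p`, the constants
`C* > 0`, `Γ ≥ 1`, `t₀ > 1`, `r₀ > 0`, `ν₀ ∈ (0,1)` can be chosen so that `ũ` is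
`C¹` in `r` on the positivity set, and satisfies pointwise the radial
supersolution inequality
`∂ₜũ ≥ ∂ᵣ(ũ^{m−1}|∂ᵣũ|^{p−2}∂ᵣũ) + ((N−1)/r + g'(r))·ũ^{m−1}|∂ᵣũ|^{p−2}∂ᵣũ`. -/
theorem supersolution_exists
    (N : ℕ) (α₁ α₂ p m : ℝ) (g g' : ℝ → ℝ)
    (hα₁ : 0 < α₁) (hα₁₂ : α₁ ≤ α₂)
    (hgc : ContinuousOn g (Set.Ici 0))
    (hgd : ∀ s ∈ Set.Ioi (0:ℝ), HasDerivAt g (g' s) s)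
    (hg'c : ContinuousOn g' (Set.Ioi 0))
    (hg0 : g 0 = 0)
    (hgpos : ∀ s, 0 < s → 0 < g s)
    (hlow : ∀ s, 0 < s → α₁ * g s / s ≤ g' s)
    (hupp : ∀ s, 0 < s → g' s ≤ α₂ * g s / s)
    (G Ginv : ℝ → ℝ) (hG : ∀ r, G r = ∫ s in (0:ℝ)..r, g s / s)
    (hGinv : ∀ r, 0 ≤ r → Ginv (G r) = r)
    (hGinv' : ∀ τ, 0 ≤ τ → 0 ≤ Ginv τ ∧ G (Ginv τ) = τ)
    (hp : 1 < p) (hpN : p < N) (hm : 0 < p + m - 3) (hα₂p : α₂ < p) :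
    ∃ C Γ t₀ r₀ ν₀ : ℝ, 0 < C ∧ 1 ≤ Γ ∧ 1 < t₀ ∧ 0 < r₀ ∧ ν₀ ∈ Set.Ioo (0:ℝ) 1 ∧
      (∀ t, 0 ≤ t →
        ContDiffOn ℝ 1 (fun r => utilde p m C Γ t₀ r₀ ν₀ G Ginv r t)
          {r : ℝ | 0 < r ∧ 0 < utilde p m C Γ t₀ r₀ ν₀ G Ginv r t}) ∧
      (∀ t, 0 ≤ t → ∀ r : ℝ, 0 < r → r ≠ r₀ →
        0 < utilde p m C Γ t₀ r₀ ν₀ G Ginv r t →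
        ∃ ut w : ℝ,
          HasDerivAt (fun t' => utilde p m C Γ t₀ r₀ ν₀ G Ginv r t') ut t ∧
          HasDerivAt (fun r' =>
            utilde p m C Γ t₀ r₀ ν₀ G Ginv r' t ^ (m-1) *
              |deriv (fun r'' => utilde p m C Γ t₀ r₀ ν₀ G Ginv r'' t) r'| ^ (p-2) *
              deriv (fun r'' => utilde p m C Γ t₀ r₀ ν₀ G Ginv r'' t) r') w r ∧
          ut ≥ w + (((N : ℝ) - 1) / r + g' r) *
            (utilde p m C Γ t₀ r₀ ν₀ G Ginv r t ^ (m-1) *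
              |deriv (fun r'' => utilde p m C Γ t₀ r₀ ν₀ G Ginv r'' t) r| ^ (p-2) *
              deriv (fun r'' => utilde p m C Γ t₀ r₀ ν₀ G Ginv r'' t) r)) := by
  have h := growthPair_of_integral hα₁ hα₁₂ hgc hgd hg0 hgpos hlow hupp hG
  have hG0 : G 0 = 0 := by rw [hG, intervalIntegral.integral_same]
  have hα₂ : 0 < α₂ := hα₁.trans_le hα₁₂
  have hp1 : 0 < p - 1 := by linarith
  have hpα : 0 < p - α₂ := by linarith
  have hn : 0 ≤ (N : ℝ) - 1 := by linarith
  set M := max 1 (2 * (α₂ + (p-1) * α₂ ^ 2 / (p-α₂)) / α₁ ^ 2) with hM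
  have hM0 : 0 < M := lt_max_of_lt_left one_pos
  obtain ⟨r₀, hr₀, hGr₀⟩ : ∃ r₀, 0 < r₀ ∧ G r₀ = M :=
    ⟨Ginv M, (h.hasDerivAt_inverse hG0 hGinv hGinv' hM0).1, (hGinv' M hM0.le).2⟩
  have hGr₀pos : 0 < G r₀ := h.G_pos r₀ hr₀
  have hGmono : ∀ r, r₀ ≤ r → G r₀ ≤ G r := fun r hr =>
    h.strictMonoOn_G.monotoneOn hr₀ (hr₀.trans_le hr) hr
  have hg_large : ∀ r, r₀ ≤ r → 2 * (α₂ + (p-1) * α₂ ^ 2 / (p-α₂)) ≤ α₁ * g r := fun r hr => by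
    have h1 : 2 * (α₂ + (p-1) * α₂ ^ 2 / (p-α₂)) / α₁ ^ 2 ≤ G r :=
      (le_max_right _ _).trans (hGr₀.symm.le.trans (hGmono r hr))
    rw [div_le_iff₀ (by positivity)] at h1
    have h2 := mul_le_mul_of_nonneg_left (h.lower_G r (hr₀.trans_le hr)) hα₁.le
    linarith
  obtain ⟨hs1, hs2⟩ := h.slope_mem hr₀
  set ν₀ := 1 - g r₀ / G r₀ / p with hν₀
  have hν0 : 0 < ν₀ := by
    rw [hν₀, sub_pos, div_lt_one (by linarith)]
    linarith
  have hν1 : ν₀ < 1 := by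
    rw [hν₀, sub_lt_self_iff]
    exact div_pos (by linarith) (by linarith)
  have hνp : ν₀ * (p / (p-1)) = (p - g r₀ / G r₀) / (p - 1) := by
    rw [hν₀]
    field_simp
  set q := (p-1)/(p+m-3) with hq
  set k := 1/(p+m-3) with hk
  have hq0 : 0 < q := by positivity
  have hk0 : 0 < k := by positivity
  set c₂ := (p/(p-1)) ^ p with hc₂
  have hc₂0 : 0 < c₂ := by positivity
  set cO := α₁ ^ 2 / 2 * ((p-α₂)/(p-1)) ^ (p-1) with hcO
  have hcO0 : 0 < cO := by positivity
  set cI := (ν₀ * (p/(p-1))) ^ (p-1) with hcI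
  have hcI0 : 0 < cI := by positivity
  set ε := min cO cI / (2 * q * c₂) with hε
  have hε0 : 0 < ε := div_pos (lt_min hcO0 hcI0) (by positivity)
  have hεm : q * c₂ * ε = min cO cI / 2 := by rw [hε]; field_simp
  obtain ⟨K, hK0, hK⟩ := h.exists_weight_div_le hα₂ hp hα₂p hε0
  set B := max (2 * k / cO) (2 * k / (cI / G r₀)) with hB
  have hB0 : 0 < B := lt_max_of_lt_left (by positivity)
  have hBO : 2 * k ≤ B * cO := (div_le_iff₀ hcO0).1 (le_max_left _ _)
  have hBI : 2 * k ≤ B * (cI / G r₀) := (div_le_iff₀ (by positivity)).1 (le_max_right _ _)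
  set c₁ := (p-α₂)/((p-1)*α₂) with hc₁
  have hc₁0 : 0 < c₁ := by positivity
  set Γ := max (max 1 (G r₀)) (B * c₂ * K / c₁) with hΓ
  have hΓ1 : 1 ≤ Γ := (le_max_left _ _).trans (le_max_left _ _)
  have hΓG : G r₀ ≤ Γ := (le_max_right _ _).trans (le_max_left _ _)
  have hΓB : B * c₂ * K ≤ Γ * c₁ := (div_le_iff₀ hc₁0).1 (le_max_right _ _)
  have hΓ0 : 0 < Γ := by linarith
  set C := (B / q ^ (p-1)) ^ (1/(p+m-3)) with hC
  have hC0 : 0 < C := by positivity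
  have hCB : C ^ (p+m-3) * q ^ (p-1) = B := by
    rw [hC, ← Real.rpow_mul (by positivity), one_div_mul_cancel hm.ne', Real.rpow_one]
    field_simp
  have hexp : 1 < Real.exp 1 := Real.one_lt_exp_iff.2 one_pos
  refine ⟨C, Γ, Real.exp 1, r₀, ν₀, hC0, hΓ1, hexp, hr₀, ⟨hν0, hν1⟩, ?_, ?_⟩
  · intro t ht
    have hglue := contDiffOn_one_ite hr₀ (fun r hr => h.hasDerivAt_outer (p := p) hr)
      (fun r hr => hasDerivAt_inner (p := p) (ν := ν₀)
        (b := (1 - ν₀) * (r₀ ^ p / G r₀) ^ (1/(p-1))) hr hGr₀pos)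
      h.continuousOn_outer_deriv (continuousOn_inner_deriv hGr₀pos) (by ring) (by rw [hνp])
    have hsub : {r : ℝ | 0 < r ∧ 0 < utilde p m C Γ (Real.exp 1) r₀ ν₀ G Ginv r t} ⊆ Ioi 0 :=
      fun r hr => hr.1
    have hpow := ((contDiffOn_const (c := (Ginv (Γ * Real.log (t + Real.exp 1)) ^ p /
      (Γ * Real.log (t + Real.exp 1))) ^ (1/(p-1)))).sub
        (hglue.mono hsub)).rpow_const_of_ne (p := q)
        fun r hr => (pos_of_utilde_pos hp hm hr.2).ne'
    refine ((contDiffOn_const (c := C * (t + Real.exp 1) ^ (-k))).mul hpow).congr fun r hr => ?_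
    rw [utilde_eq, max_eq_left (pos_of_utilde_pos hp hm hr.2).le]
  · intro t ht r hr hne hpos
    have hS1 : Real.exp 1 ≤ t + Real.exp 1 := by linarith
    have hS : 0 < t + Real.exp 1 := by linarith
    have hF := pos_of_utilde_pos hp hm hpos
    obtain ⟨e', he, he'⟩ := h.hasDerivAt_height (t := t) (t₀ := Real.exp 1) hα₂ hp hα₂p hG0 hGinv
      hGinv' hΓ0 (by linarith)
    have hlog : 1 ≤ Real.log (t + Real.exp 1) := (Real.le_log_iff_exp_le hS).2 hS1
    have hτ : Γ ≤ Γ * Real.log (t + Real.exp 1) := le_mul_of_one_le_right hΓ0.le hlog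
    have hτ0 : 0 < Γ * Real.log (t + Real.exp 1) := hΓ0.trans_le hτ
    have hR := (h.hasDerivAt_inverse hG0 hGinv hGinv' hτ0).1
    have hGR := (hGinv' _ hτ0.le).2
    have hX : B * c₂ * K * ((Ginv (Γ * Real.log (t + Real.exp 1)) ^ p /
        (Γ * Real.log (t + Real.exp 1))) ^ (1/(p-1)) / (Γ * Real.log (t + Real.exp 1))) ≤
        (t + Real.exp 1) * e' := by
      refine le_trans ?_ he'
      gcongr
    have hKR := fun r hr hrR => hK r (Ginv (Γ * Real.log (t + Real.exp 1))) hr hrR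
    have hmonoR := fun r hr hrR =>
      h.weight_le (p := p) (r := r) (R := Ginv (Γ * Real.log (t + Real.exp 1))) hp hα₂p hr hrR
    rw [hGR] at hKR hmonoR
    rcases hne.lt_or_gt with hlt | hgt
    · have hr₀R : r₀ ≤ Ginv (Γ * Real.log (t + Real.exp 1)) :=
        (h.strictMonoOn_G.le_iff_le hr₀ hR).1 (by rw [hGR]; linarith)
      rw [if_neg hlt.not_ge] at hF
      have hg'r : 0 ≤ g' r := le_trans (by have := hgpos r hr; positivity) (hlow r hr)
      have hL : 0 ≤ ((N : ℝ) - 1) / r + g' r := by positivity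
      obtain ⟨hΨ, hdiv⟩ := inner_divergence (c := ν₀ * (p/(p-1))) hp hr hGr₀pos (by positivity) hL
      refine supersolution_of_profile (e := fun t => (Ginv (Γ * Real.log (t + Real.exp 1)) ^ p /
          (Γ * Real.log (t + Real.exp 1))) ^ (1/(p-1)))
        (j := fun r => ν₀ * (r ^ p / G r₀) ^ (1/(p-1)) + (1 - ν₀) * (r₀ ^ p / G r₀) ^ (1/(p-1)))
        (d := fun r => (r ^ p / G r₀) ^ (1/(p-1)) * (ν₀ * (p / (p - 1))) / r)
        hp hm hC0 hS ?_ ?_ ?_ hΨ he hF ?_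
      · filter_upwards [eventually_lt_nhds hlt] with s hs t
        rw [utilde_eq, if_neg hs.not_ge]
      · filter_upwards [eventually_gt_nhds hr] with s hs using hasDerivAt_inner hs hGr₀pos
      · filter_upwards [eventually_gt_nhds hr] with s hs
        positivity
      · rw [hCB]
        refine reduced_inequality hB0.le hq0.le hc₂0.le hF.le hdiv hBI
          (inner_gradient hp hr hlt.le hGr₀pos hν0 hν1.le) (hKR r₀ hr₀ hr₀R) ?_ hX
        rw [← mul_assoc, hεm]
        refine half_mul_increment_le hGr₀pos hcI0.le (min_le_right _ _) hν0.le ?_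
          (hmonoR r₀ hr₀ hr₀R)
        exact Real.rpow_le_rpow (by positivity) (div_le_div_of_nonneg_right
          (Real.rpow_le_rpow hr.le hlt.le (by linarith)) hGr₀pos.le) (by positivity)
    · rw [if_pos hgt.le] at hF
      have hGr := h.G_pos r hr
      have hrR : r ≤ Ginv (Γ * Real.log (t + Real.exp 1)) := by
        by_contra! hc
        have := h.weight_le hp hα₂p hR hc.le
        rw [hGR] at this
        linarith
      obtain ⟨Ψ', hΨ, hdiv⟩ := h.outer_divergence hα₁ hp hα₂p hn hr (hg_large r hgt.le)
      refine supersolution_of_profile (e := fun t => (Ginv (Γ * Real.log (t + Real.exp 1)) ^ p /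
          (Γ * Real.log (t + Real.exp 1))) ^ (1/(p-1)))
        (j := fun r => (r ^ p / G r) ^ (1/(p-1)))
        (d := fun r => (r ^ p / G r) ^ (1/(p-1)) * ((p - g r / G r) / (p - 1)) / r)
        hp hm hC0 hS ?_ ?_ ?_ hΨ he hF ?_
      · filter_upwards [eventually_gt_nhds hgt] with s hs t
        rw [utilde_eq, if_pos hs.le]
      · filter_upwards [eventually_gt_nhds hr] with s hs using h.hasDerivAt_outer hs
      · filter_upwards [eventually_gt_nhds hr] with s hs
        have h1 := h.G_pos s hs
        have h2 : 0 < p - g s / G s := by linarith [(h.slope_mem hs).2]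
        positivity
      · rw [hCB]
        refine reduced_inequality hB0.le hq0.le hc₂0.le hF.le hdiv hBO
          (h.outer_gradient hα₁ hp hα₂p hr) (hKR r hr hrR) ?_ hX
        rw [← mul_assoc, hεm]
        have h1 : 1 ≤ G r := (le_max_left _ _).trans (hGr₀.symm.le.trans (hGmono r hgt.le))
        gcongr
        · exact min_le_left _ _
        · exact div_le_self hF.le h1
end

section
/- Fix r₀ > 0 and define ν₀ = 1 − r₀·G'(r₀)/(p·G(r₀)). Then, assuming α₂ < p, one has 0 < 1 − α₂/p ≤ ν₀ ≤ 1 − α₁/p < 1, and with this choice of ν₀ the function equal to I(r) = ν₀·(r^p/G(r₀))^{1/(p−1)} + (1−ν₀)·J(r₀)^{1/(p−1)} for 0 < r ≤ r₀ and equal to J(r)^{1/(p−1)} for r ≥ r₀ is continuously differentiable at r = r₀, i.e. I(r₀) = J(r₀)^{1/(p−1)} and I'(r₀) = (d/dr)(J^{1/(p−1)})(r₀). -/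
open Set MeasureTheory

section GrowthBounds

variable {α₁ α₂ : ℝ} {g g' : ℝ → ℝ}

lemma intervalIntegrable_deriv_of_lower_growth (hα₁ : 0 < α₁)
    (hgc : ContinuousOn g (Ici 0)) (hgd : ∀ s ∈ Ioi (0:ℝ), HasDerivAt g (g' s) s)
    (hgpos : ∀ s, 0 < s → 0 < g s) (hlow : ∀ s, 0 < s → α₁ * g s / s ≤ g' s)
    {r : ℝ} (hr : 0 < r) : IntervalIntegrable g' volume 0 r := by
  rw [intervalIntegrable_iff_integrableOn_Ioc_of_le hr.le]
  refine intervalIntegral.integrableOn_deriv_of_nonneg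
    (hgc.mono Icc_subset_Ici_self) (fun x hx => hgd x hx.1) fun x hx => ?_
  have h₁ := hgpos x hx.1
  have h₂ := hx.1
  exact le_trans (by positivity) (hlow x hx.1)

lemma integral_deriv_eq_of_lower_growth (hα₁ : 0 < α₁)
    (hgc : ContinuousOn g (Ici 0)) (hgd : ∀ s ∈ Ioi (0:ℝ), HasDerivAt g (g' s) s)
    (hg0 : g 0 = 0) (hgpos : ∀ s, 0 < s → 0 < g s)
    (hlow : ∀ s, 0 < s → α₁ * g s / s ≤ g' s)
    {r : ℝ} (hr : 0 < r) : ∫ s in (0:ℝ)..r, g' s = g r := by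
  rw [intervalIntegral.integral_eq_sub_of_hasDerivAt_of_le hr.le
    (hgc.mono Icc_subset_Ici_self) (fun x hx => hgd x hx.1)
    (intervalIntegrable_deriv_of_lower_growth hα₁ hgc hgd hgpos hlow hr), hg0, sub_zero]

lemma continuousOn_div_id_Ioi (hgc : ContinuousOn g (Ici 0)) :
    ContinuousOn (fun s => g s / s) (Ioi 0) :=
  (hgc.mono Ioi_subset_Ici_self).div continuousOn_id fun _ hx => ne_of_gt hx

lemma intervalIntegrable_div_id_of_lower_growth (hα₁ : 0 < α₁)
    (hgc : ContinuousOn g (Ici 0)) (hgd : ∀ s ∈ Ioi (0:ℝ), HasDerivAt g (g' s) s)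
    (hgpos : ∀ s, 0 < s → 0 < g s) (hlow : ∀ s, 0 < s → α₁ * g s / s ≤ g' s)
    {r : ℝ} (hr : 0 < r) : IntervalIntegrable (fun s => g s / s) volume 0 r := by
  have h := (intervalIntegrable_deriv_of_lower_growth hα₁ hgc hgd hgpos hlow hr).const_mul α₁⁻¹
  rw [intervalIntegrable_iff_integrableOn_Ioc_of_le hr.le] at h ⊢
  refine h.mono' (((continuousOn_div_id_Ioi hgc).mono Ioc_subset_Ioi_self).aestronglyMeasurable
    measurableSet_Ioc) ?_
  filter_upwards [ae_restrict_mem measurableSet_Ioc] with s hs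
  have hs0 : 0 < s := hs.1
  rw [Real.norm_of_nonneg (div_pos (hgpos s hs0) hs0).le, inv_mul_eq_div, le_div_iff₀' hα₁,
    ← mul_div_assoc]
  exact hlow s hs0

lemma mul_integral_div_id_le (hα₁ : 0 < α₁)
    (hgc : ContinuousOn g (Ici 0)) (hgd : ∀ s ∈ Ioi (0:ℝ), HasDerivAt g (g' s) s)
    (hg0 : g 0 = 0) (hgpos : ∀ s, 0 < s → 0 < g s)
    (hlow : ∀ s, 0 < s → α₁ * g s / s ≤ g' s) {r : ℝ} (hr : 0 < r) :
    α₁ * ∫ s in (0:ℝ)..r, g s / s ≤ g r := by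
  rw [← integral_deriv_eq_of_lower_growth hα₁ hgc hgd hg0 hgpos hlow hr,
    ← intervalIntegral.integral_const_mul]
  refine intervalIntegral.integral_mono_on_of_le_Ioo hr.le
    ((intervalIntegrable_div_id_of_lower_growth hα₁ hgc hgd hgpos hlow hr).const_mul α₁)
    (intervalIntegrable_deriv_of_lower_growth hα₁ hgc hgd hgpos hlow hr) fun s hs => ?_
  rw [← mul_div_assoc]
  exact hlow s hs.1

lemma le_mul_integral_div_id (hα₁ : 0 < α₁)
    (hgc : ContinuousOn g (Ici 0)) (hgd : ∀ s ∈ Ioi (0:ℝ), HasDerivAt g (g' s) s)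
    (hg0 : g 0 = 0) (hgpos : ∀ s, 0 < s → 0 < g s)
    (hlow : ∀ s, 0 < s → α₁ * g s / s ≤ g' s)
    (hupp : ∀ s, 0 < s → g' s ≤ α₂ * g s / s) {r : ℝ} (hr : 0 < r) :
    g r ≤ α₂ * ∫ s in (0:ℝ)..r, g s / s := by
  rw [← integral_deriv_eq_of_lower_growth hα₁ hgc hgd hg0 hgpos hlow hr,
    ← intervalIntegral.integral_const_mul]
  refine intervalIntegral.integral_mono_on_of_le_Ioo hr.le
    (intervalIntegrable_deriv_of_lower_growth hα₁ hgc hgd hgpos hlow hr)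
    ((intervalIntegrable_div_id_of_lower_growth hα₁ hgc hgd hgpos hlow hr).const_mul α₂)
    fun s hs => ?_
  rw [← mul_div_assoc]
  exact hupp s hs.1

lemma hasDerivAt_integral_div_id (hα₁ : 0 < α₁)
    (hgc : ContinuousOn g (Ici 0)) (hgd : ∀ s ∈ Ioi (0:ℝ), HasDerivAt g (g' s) s)
    (hgpos : ∀ s, 0 < s → 0 < g s) (hlow : ∀ s, 0 < s → α₁ * g s / s ≤ g' s)
    {r : ℝ} (hr : 0 < r) :
    HasDerivAt (fun u => ∫ s in (0:ℝ)..u, g s / s) (g r / r) r := by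
  have hc := continuousOn_div_id_Ioi hgc
  exact intervalIntegral.integral_hasDerivAt_right
    (intervalIntegrable_div_id_of_lower_growth hα₁ hgc hgd hgpos hlow hr)
    (hc.stronglyMeasurableAtFilter isOpen_Ioi r hr) (hc.continuousAt (Ioi_mem_nhds hr))

end GrowthBounds

/-- With `ν₀ = 1 − r₀·G'(r₀)/(p·G(r₀))` (and `G'(r₀) = g(r₀)/r₀`),
assuming `α₂ < p` one has `0 < 1 − α₂/p ≤ ν₀ ≤ 1 − α₁/p < 1`, and the matched
function `I` (for `r ≤ r₀`) / `J^{1/(p−1)}` (for `r ≥ r₀`) is `C¹` at `r₀`: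
`I(r₀) = J(r₀)^{1/(p−1)}` and `I'(r₀) = (J^{1/(p−1)})'(r₀)`. -/
theorem nu0_matching
    (α₁ α₂ : ℝ) (g g' : ℝ → ℝ)
    (hα₁ : 0 < α₁) (hα₁₂ : α₁ ≤ α₂)
    (hgc : ContinuousOn g (Set.Ici 0))
    (hgd : ∀ s ∈ Set.Ioi (0:ℝ), HasDerivAt g (g' s) s)
    (hg'c : ContinuousOn g' (Set.Ioi 0))
    (hg0 : g 0 = 0)
    (hgpos : ∀ s, 0 < s → 0 < g s)
    (hlow : ∀ s, 0 < s → α₁ * g s / s ≤ g' s)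
    (hupp : ∀ s, 0 < s → g' s ≤ α₂ * g s / s)
    (G : ℝ → ℝ) (hG : ∀ r, G r = ∫ s in (0:ℝ)..r, g s / s)
    (p : ℝ) (hp : 1 < p) (hα₂p : α₂ < p)
    (r₀ : ℝ) (hr₀ : 0 < r₀)
    (ν₀ : ℝ) (hν₀ : ν₀ = 1 - r₀ * (g r₀ / r₀) / (p * G r₀)) :
    0 < 1 - α₂ / p ∧ 1 - α₂ / p ≤ ν₀ ∧ ν₀ ≤ 1 - α₁ / p ∧ 1 - α₁ / p < 1 ∧
    ν₀ * (r₀ ^ p / G r₀) ^ (1/(p-1)) + (1 - ν₀) * (r₀ ^ p / G r₀) ^ (1/(p-1))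
      = (r₀ ^ p / G r₀) ^ (1/(p-1)) ∧
    ∃ d : ℝ,
      HasDerivAt (fun r => ν₀ * (r ^ p / G r₀) ^ (1/(p-1))
        + (1 - ν₀) * (r₀ ^ p / G r₀) ^ (1/(p-1))) d r₀ ∧
      HasDerivAt (fun r => (r ^ p / G r) ^ (1/(p-1))) d r₀ := by
  have hp0 : 0 < p := zero_lt_one.trans hp
  have hgr := hgpos r₀ hr₀
  have hG_le : α₁ * G r₀ ≤ g r₀ := by
    rw [hG]; exact mul_integral_div_id_le hα₁ hgc hgd hg0 hgpos hlow hr₀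
  have hle_G : g r₀ ≤ α₂ * G r₀ := by
    rw [hG]; exact le_mul_integral_div_id hα₁ hgc hgd hg0 hgpos hlow hupp hr₀
  have hGpos : 0 < G r₀ := pos_of_mul_pos_right (hgr.trans_le hle_G) (hα₁.trans_le hα₁₂).le
  have hGd : HasDerivAt G (g r₀ / r₀) r₀ := by
    rw [funext hG]; exact hasDerivAt_integral_div_id hα₁ hgc hgd hgpos hlow hr₀
  rw [mul_div_cancel₀ _ hr₀.ne'] at hν₀
  have hJpos : 0 < r₀ ^ p / G r₀ := div_pos (Real.rpow_pos_of_pos hr₀ p) hGpos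
  have hpow : HasDerivAt (fun r : ℝ => r ^ p) (p * r₀ ^ (p - 1)) r₀ :=
    Real.hasDerivAt_rpow_const (Or.inl hr₀.ne')
  refine ⟨?_, ?_, ?_, ?_, by ring, _,
    (((hpow.div_const (G r₀)).rpow_const (Or.inl hJpos.ne')).const_mul ν₀).add_const _, ?_⟩
  · rw [sub_pos, div_lt_one hp0]
    exact hα₂p
  · rw [hν₀, sub_le_sub_iff_left, div_le_div_iff₀ (by positivity) hp0]
    nlinarith
  · rw [hν₀, sub_le_sub_iff_left, div_le_div_iff₀ hp0 (by positivity)]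
    nlinarith
  · exact sub_lt_self _ (div_pos hα₁ hp0)
  · have hJ : HasDerivAt (fun r => (r ^ p / G r) ^ (1 / (p - 1))) _ r₀ :=
      (hpow.fun_div hGd hGpos.ne').rpow_const (Or.inl hJpos.ne')
    have hsplit : r₀ ^ p = r₀ ^ (p - 1) * r₀ := by
      rw [← Real.rpow_add_one hr₀.ne', sub_add_cancel]
    have hderiv : ν₀ * (p * r₀ ^ (p - 1) / G r₀)
        = (p * r₀ ^ (p - 1) * G r₀ - r₀ ^ p * (g r₀ / r₀)) / G r₀ ^ 2 := by
      rw [hν₀, hsplit]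
      field_simp
    rw [← hderiv] at hJ
    simpa only [mul_assoc] using hJ
end

section
/- Assume 1 < p and α₂ < p. Fix r₀ > 0 and t₀ > 1, and set Γ = 2^{α₂(p−1)/(p−α₂)} · G(r₀)/log t₀. Then E(Γ·log t₀) ≥ 2^{p−1} · J(r₀). -/
/-- If `s * g'(s) ≤ α * g(s)` on `(0, ∞)`, then `s ↦ g(s) * s^(-α)` is nonincreasing there. -/
theorem antitoneOn_mul_rpow_neg_of_deriv_le {α : ℝ} {g g' : ℝ → ℝ}
    (hgd : ∀ s ∈ Set.Ioi (0:ℝ), HasDerivAt g (g' s) s)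
    (hupp : ∀ s, 0 < s → g' s ≤ α * g s / s) :
    AntitoneOn (fun s => g s * s ^ (-α)) (Set.Ioi 0) := by
  have hd : ∀ s ∈ Set.Ioi (0:ℝ), HasDerivAt (fun s => g s * s ^ (-α))
      (g' s * s ^ (-α) + g s * (-α * s ^ (-α - 1))) s := fun s hs =>
    (hgd s hs).mul (Real.hasDerivAt_rpow_const (Or.inl (ne_of_gt hs)))
  refine antitoneOn_of_deriv_nonpos (convex_Ioi 0)
    (fun s hs => (hd s hs).continuousAt.continuousWithinAt) ?_ ?_
  · rw [interior_Ioi]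
    exact fun s hs => (hd s hs).differentiableAt.differentiableWithinAt
  · rw [interior_Ioi]
    intro s hs
    have hs' : 0 < s := hs
    rw [(hd s hs).deriv, Real.rpow_sub_one hs'.ne']
    calc g' s * s ^ (-α) + g s * (-α * (s ^ (-α) / s))
        = (g' s - α * g s / s) * s ^ (-α) := by ring
      _ ≤ 0 := mul_nonpos_of_nonpos_of_nonneg (sub_nonpos.2 (hupp s hs')) (by positivity)

/-- If `s * g'(s) ≤ α * g(s)` on `(0, ∞)`, then `g(c * s) ≤ c^α * g(s)` for `c ≥ 1`. -/
theorem apply_mul_le_rpow_mul_of_deriv_le {α : ℝ} {g g' : ℝ → ℝ}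
    (hgd : ∀ s ∈ Set.Ioi (0:ℝ), HasDerivAt g (g' s) s)
    (hupp : ∀ s, 0 < s → g' s ≤ α * g s / s) {c s : ℝ} (hc : 1 ≤ c) (hs : 0 < s) :
    g (c * s) ≤ c ^ α * g s := by
  have hc0 : 0 < c := by linarith
  have h : g (c * s) * (c * s) ^ (-α) ≤ g s * s ^ (-α) :=
    antitoneOn_mul_rpow_neg_of_deriv_le hgd hupp hs
      (Set.mem_Ioi.2 (mul_pos hc0 hs)) (le_mul_of_one_le_left hs.le hc)
  rw [Real.mul_rpow hc0.le hs.le, ← mul_assoc,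
    mul_le_mul_iff_left₀ (Real.rpow_pos_of_pos hs _), Real.rpow_neg hc0.le,
    ← div_eq_mul_inv, div_le_iff₀ (Real.rpow_pos_of_pos hc0 _)] at h
  linarith

/-- If `g(c * s) ≤ c^α * g(s)` for `s > 0`, then `r ↦ ∫₀^r g(s)/s ds` satisfies the same
inequality. -/
theorem integral_div_mul_le_rpow_mul {α : ℝ} {g : ℝ → ℝ} {c r : ℝ} (hc : 0 < c) (hr : 0 ≤ r)
    (hg : ∀ s, 0 < s → g (c * s) ≤ c ^ α * g s)
    (hint : IntervalIntegrable (fun s => g s / s) MeasureTheory.volume 0 r)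
    (hint' : IntervalIntegrable (fun s => g s / s) MeasureTheory.volume 0 (c * r)) :
    ∫ s in (0:ℝ)..(c * r), g s / s ≤ c ^ α * ∫ s in (0:ℝ)..r, g s / s := by
  have hscale : ∫ s in (0:ℝ)..(c * r), g s / s = ∫ s in (0:ℝ)..r, c * (g (c * s) / (c * s)) := by
    rw [intervalIntegral.integral_const_mul,
      intervalIntegral.integral_comp_mul_left (fun s => g s / s) hc.ne', mul_zero, smul_eq_mul,
      mul_inv_cancel_left₀ hc.ne']
  have hcomp := hint'.comp_mul_left (c := c)
  rw [zero_div, mul_div_cancel_left₀ _ hc.ne'] at hcomp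
  rw [hscale, ← intervalIntegral.integral_const_mul]
  refine intervalIntegral.integral_mono_on_of_le_Ioo hr (hcomp.const_mul c)
    (hint.const_mul _) fun s hs => ?_
  have hs0 : 0 < s := hs.1
  calc c * (g (c * s) / (c * s)) = g (c * s) / s := by field_simp
    _ ≤ c ^ α * g s / s := by gcongr; exact hg s hs0
    _ = c ^ α * (g s / s) := by ring


/-- With `Γ = 2^{α₂(p−1)/(p−α₂)}·G(r₀)/log t₀`, one has
`E(Γ·log t₀) ≥ 2^{p−1}·J(r₀)`, where `E(τ) = G⁻¹(τ)^p/τ` and `J(r) = r^p/G(r)`. -/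
theorem E_at_initial_time_lower_bound
    (α₁ α₂ : ℝ) (g g' : ℝ → ℝ)
    (hα₁ : 0 < α₁) (hα₁₂ : α₁ ≤ α₂)
    (hgc : ContinuousOn g (Set.Ici 0))
    (hgd : ∀ s ∈ Set.Ioi (0:ℝ), HasDerivAt g (g' s) s)
    (hg'c : ContinuousOn g' (Set.Ioi 0))
    (hg0 : g 0 = 0)
    (hgpos : ∀ s, 0 < s → 0 < g s)
    (hlow : ∀ s, 0 < s → α₁ * g s / s ≤ g' s)
    (hupp : ∀ s, 0 < s → g' s ≤ α₂ * g s / s)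
    (G Ginv : ℝ → ℝ) (hG : ∀ r, G r = ∫ s in (0:ℝ)..r, g s / s)
    (hGinv : ∀ r, 0 ≤ r → Ginv (G r) = r)
    (hGinv' : ∀ τ, 0 ≤ τ → 0 ≤ Ginv τ ∧ G (Ginv τ) = τ)
    (p : ℝ) (hp : 1 < p) (hα₂p : α₂ < p)
    (r₀ t₀ : ℝ) (hr₀ : 0 < r₀) (ht₀ : 1 < t₀)
    (Γ : ℝ) (hΓ : Γ = 2 ^ (α₂ * (p-1) / (p - α₂)) * G r₀ / Real.log t₀) :
    Ginv (Γ * Real.log t₀) ^ p / (Γ * Real.log t₀) ≥ 2 ^ (p-1) * (r₀ ^ p / G r₀) := by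
  have hGzero : G 0 = 0 := by rw [hG, intervalIntegral.integral_same]
  have hG_inj : ∀ r s, 0 ≤ r → 0 ≤ s → G r = G s → r = s := fun r s hr hs h => by
    rw [← hGinv r hr, h, hGinv s hs]
  have hint : ∀ r, 0 ≤ r →
      IntervalIntegrable (fun s => g s / s) MeasureTheory.volume 0 r := by
    intro r hr
    by_contra hn
    have h0 : G r = G 0 := by rw [hG r, intervalIntegral.integral_undef hn, hGzero]
    rw [hG_inj r 0 hr le_rfl h0] at hn
    exact hn IntervalIntegrable.refl
  have hnonneg : ∀ s, 0 ≤ s → 0 ≤ g s / s := by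
    intro s hs
    rcases hs.eq_or_lt with rfl | hs
    · simp
    · exact (div_pos (hgpos s hs) hs).le
  have hG_mono : ∀ r s, 0 ≤ r → r ≤ s → G r ≤ G s := by
    intro r s hr hrs
    have hsub : G s - G r = ∫ u in r..s, g u / u := by
      rw [hG, hG, intervalIntegral.integral_interval_sub_left (hint s (hr.trans hrs)) (hint r hr)]
    have : 0 ≤ ∫ u in r..s, g u / u :=
      intervalIntegral.integral_nonneg hrs fun u hu => hnonneg u (hr.trans hu.1)
    linarith
  have hGr₀ : 0 < G r₀ := by
    refine lt_of_le_of_ne (hGzero ▸ hG_mono 0 r₀ le_rfl hr₀.le) fun h => ?_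
    exact hr₀.ne (hG_inj 0 r₀ le_rfl hr₀.le (hGzero.trans h))
  have hpα : 0 < p - α₂ := sub_pos.2 hα₂p
  obtain ⟨c, hc⟩ : ∃ c : ℝ, c = 2 ^ ((p - 1) / (p - α₂)) := ⟨_, rfl⟩
  have hc1 : 1 ≤ c := hc ▸ Real.one_le_rpow one_le_two (div_pos (sub_pos.2 hp) hpα).le
  have hc0 : 0 < c := one_pos.trans_le hc1
  have hcα : c ^ α₂ = 2 ^ (α₂ * (p - 1) / (p - α₂)) := by
    rw [hc, ← Real.rpow_mul zero_le_two]
    congr 1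
    ring
  have hcp : c ^ p = c ^ α₂ * 2 ^ (p - 1) := by
    have h : c ^ (p - α₂) = 2 ^ (p - 1) := by
      rw [hc, ← Real.rpow_mul zero_le_two, div_mul_cancel₀ _ hpα.ne']
    rw [← h, ← Real.rpow_add hc0]
    congr 1
    ring
  have hτ : Γ * Real.log t₀ = c ^ α₂ * G r₀ := by
    rw [hΓ, hcα, div_mul_cancel₀ _ (Real.log_pos ht₀).ne']
  have hcα0 : 0 < c ^ α₂ := Real.rpow_pos_of_pos hc0 _
  rw [hτ]
  obtain ⟨hR0, hGR⟩ := hGinv' (c ^ α₂ * G r₀) (mul_pos hcα0 hGr₀).le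
  have hcr : 0 ≤ c * r₀ := (mul_pos hc0 hr₀).le
  have hGc : G (c * r₀) ≤ c ^ α₂ * G r₀ := by
    rw [hG, hG]
    exact integral_div_mul_le_rpow_mul hc0 hr₀.le
      (fun s hs => apply_mul_le_rpow_mul_of_deriv_le hgd hupp hc1 hs) (hint r₀ hr₀.le)
      (hint _ hcr)
  have hR : c * r₀ ≤ Ginv (c ^ α₂ * G r₀) := by
    by_contra! hlt
    exact hlt.ne (hG_inj _ _ hR0 hcr (le_antisymm (hG_mono _ _ hR0 hlt.le) (hGR.symm ▸ hGc)))
  calc 2 ^ (p - 1) * (r₀ ^ p / G r₀) = (c * r₀) ^ p / (c ^ α₂ * G r₀) := by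
        rw [Real.mul_rpow hc0.le hr₀.le, hcp]
        field_simp
    _ ≤ Ginv (c ^ α₂ * G r₀) ^ p / (c ^ α₂ * G r₀) := by
        gcongr
end

section
/- Assume 1 < p < N and set f(r) = e^{g(r)}. Define φ(r) = ∫_r^∞ (f(z)·z^{N−1})^{−1/(p−1)} dz (the integral converges for every r > 0) and φ̃(r) = [ (g(r)/r)·(f(r)·r^{N−1})^{1/(p−1)} ]^{−1}. Then for every r > 0 one has α₁/(p−1) ≤ [α₁ − 1 + (N−1)/(p−1)]·(1/g(r)) + α₁/(p−1) ≤ φ̃'(r)/φ'(r) ≤ [α₂ − 1 + (N−1)/(p−1)]·(1/g(r)) + α₂/(p−1); consequently, for every r* > 0 there exist constants C₁, C₂ > 0 such that C₁·φ(r) ≤ φ̃(r) ≤ C₂·φ(r) for all r ≥ r*. -/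
open Set Filter Topology MeasureTheory

/-- A function that is nonincreasing on `[a, ∞)` and tends to `0` at infinity is nonnegative. -/
theorem nonneg_of_hasDerivAt_nonpos_of_tendsto_zero {F F' : ℝ → ℝ} {a : ℝ}
    (hF : ∀ x, a ≤ x → HasDerivAt F (F' x) x) (hF' : ∀ x, a ≤ x → F' x ≤ 0)
    (hlim : Tendsto F atTop (𝓝 0)) {r : ℝ} (hr : a ≤ r) : 0 ≤ F r := by
  have hanti : AntitoneOn F (Ici a) := by
    apply antitoneOn_of_hasDerivWithinAt_nonpos (f' := F') (convex_Ici a)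
    · exact fun x hx => (hF x hx).continuousAt.continuousWithinAt
    · exact fun x hx => (hF x (interior_subset hx)).hasDerivWithinAt
    · exact fun x hx => hF' x (interior_subset hx)
  refine le_of_tendsto hlim ?_
  filter_upwards [eventually_ge_atTop r] with x hx
  exact hanti hr (hr.trans hx) hx

/-- The tail integral of a continuous integrable function is differentiable. -/
theorem hasDerivAt_integral_Ioi_of_continuousOn {h : ℝ → ℝ} {c r : ℝ}
    (hc : ContinuousOn h (Ioi c)) (hi : ∀ x, c < x → IntegrableOn h (Ioi x)) (hr : c < r) :
    HasDerivAt (fun x => ∫ z in Ioi x, h z) (-h r) r := by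
  obtain ⟨a, hca, har⟩ := exists_between hr
  have hnhds : Ioi c ∈ 𝓝 r := Ioi_mem_nhds hr
  have hint : IntervalIntegrable h volume a r :=
    (intervalIntegrable_iff_integrableOn_Ioc_of_le har.le).2
      ((hi a hca).mono_set Ioc_subset_Ioi_self)
  have hd : HasDerivAt (fun u => ∫ x in a..u, h x) (h r) r :=
    intervalIntegral.integral_hasDerivAt_right hint
      (hc.stronglyMeasurableAtFilter isOpen_Ioi r hr) (hc.continuousAt hnhds)
  refine (hd.const_sub (∫ z in Ioi a, h z)).congr_of_eventuallyEq ?_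
  filter_upwards [hnhds] with x hx
  rw [← intervalIntegral.integral_Ioi_sub_Ioi' (hi a hca) (hi x hx)]
  ring

/-- The power of `e^u · z^m` with exponent `-q`, written as a product. -/
theorem exp_mul_rpow_rpow_neg {u z : ℝ} (m q : ℝ) (hz : 0 < z) :
    (Real.exp u * z ^ m) ^ (-q) = Real.exp (-(q * u)) * z ^ (-(m * q)) := by
  rw [Real.mul_rpow (Real.exp_pos u).le (Real.rpow_nonneg hz.le m), ← Real.exp_mul,
    ← Real.rpow_mul hz.le]
  ring_nf

/-- With `f(r) = e^{g(r)}`, `φ(r) = ∫_r^∞ (f(z)·z^{N−1})^{−1/(p−1)} dz`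
(a convergent integral for `r > 0`) and
`φ̃(r) = [(g(r)/r)·(f(r)·r^{N−1})^{1/(p−1)}]⁻¹`, for every `r > 0` the ratio
`φ̃'(r)/φ'(r)` satisfies
`α₁/(p−1) ≤ [α₁−1+(N−1)/(p−1)]/g(r) + α₁/(p−1) ≤ φ̃'(r)/φ'(r)
  ≤ [α₂−1+(N−1)/(p−1)]/g(r) + α₂/(p−1)`;
consequently, for every `r* > 0` there are `C₁, C₂ > 0` with
`C₁·φ(r) ≤ φ̃(r) ≤ C₂·φ(r)` for all `r ≥ r*`. -/
theorem phi_tilde_comparable_phi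
    (N : ℕ) (α₁ α₂ p : ℝ) (g g' : ℝ → ℝ)
    (hα₁ : 0 < α₁) (hα₁₂ : α₁ ≤ α₂)
    (hgc : ContinuousOn g (Set.Ici 0))
    (hgd : ∀ s ∈ Set.Ioi (0:ℝ), HasDerivAt g (g' s) s)
    (hg'c : ContinuousOn g' (Set.Ioi 0))
    (hg0 : g 0 = 0)
    (hgpos : ∀ s, 0 < s → 0 < g s)
    (hlow : ∀ s, 0 < s → α₁ * g s / s ≤ g' s)
    (hupp : ∀ s, 0 < s → g' s ≤ α₂ * g s / s)
    (hp : 1 < p) (hpN : p < N)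
    (φ φt : ℝ → ℝ)
    (hφ : ∀ r, 0 < r →
      φ r = ∫ z in Set.Ioi r, (Real.exp (g z) * z ^ ((N:ℝ) - 1)) ^ (-(1/(p-1))))
    (hφt : ∀ r, 0 < r →
      φt r = ((g r / r) * (Real.exp (g r) * r ^ ((N:ℝ) - 1)) ^ (1/(p-1)))⁻¹) :
    (∀ r, 0 < r → MeasureTheory.IntegrableOn
      (fun z => (Real.exp (g z) * z ^ ((N:ℝ) - 1)) ^ (-(1/(p-1)))) (Set.Ioi r)) ∧
    (∀ r, 0 < r → ∃ dφ dφt : ℝ,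
      HasDerivAt φ dφ r ∧ HasDerivAt φt dφt r ∧
      α₁ / (p-1) ≤ (α₁ - 1 + ((N:ℝ) - 1)/(p-1)) * (1 / g r) + α₁ / (p-1) ∧
      (α₁ - 1 + ((N:ℝ) - 1)/(p-1)) * (1 / g r) + α₁ / (p-1) ≤ dφt / dφ ∧
      dφt / dφ ≤ (α₂ - 1 + ((N:ℝ) - 1)/(p-1)) * (1 / g r) + α₂ / (p-1)) ∧
    (∀ rstar, 0 < rstar → ∃ C₁ C₂ : ℝ, 0 < C₁ ∧ 0 < C₂ ∧ ∀ r, rstar ≤ r →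
      C₁ * φ r ≤ φt r ∧ φt r ≤ C₂ * φ r) := by
  set q : ℝ := 1 / (p - 1) with hq
  set m : ℝ := (N : ℝ) - 1 with hm
  have hp1 : 0 < p - 1 := by linarith
  have hqpos : 0 < q := by positivity
  have hdiv : ∀ x : ℝ, x / (p - 1) = x * q := fun x => by rw [hq]; ring
  simp only [hdiv]
  have hb : 1 < m * q := by
    rw [← hdiv, one_lt_div hp1]
    linarith
  set h : ℝ → ℝ := fun z => (Real.exp (g z) * z ^ m) ^ (-q)
  have hform : ∀ z, 0 < z → h z = Real.exp (-(q * g z)) * z ^ (-(m * q)) :=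
    fun z hz => exp_mul_rpow_rpow_neg m q hz
  have hpos : ∀ z, 0 < z → 0 < h z := fun z hz => by
    rw [hform z hz]
    positivity
  have hle : ∀ z, 0 < z → h z ≤ z ^ (-(m * q)) := fun z hz => by
    rw [hform z hz]
    refine mul_le_of_le_one_left (by positivity) (Real.exp_le_one_iff.2 ?_)
    have := hgpos z hz
    have : 0 < q * g z := by positivity
    linarith
  have hderiv : ∀ r, 0 < r → HasDerivAt h (-(h r * (q * g' r + m * q / r))) r := by
    intro r hr
    have h1 := ((((hgd r hr).const_mul q).neg).exp).mul
      (Real.hasDerivAt_rpow_const (p := -(m * q)) (Or.inl hr.ne'))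
    have h2 := h1.congr_of_eventuallyEq
      (f₁ := h) (by filter_upwards [Ioi_mem_nhds hr] with z hz using hform z hz)
    refine h2.congr_deriv ?_
    rw [hform r hr, Real.rpow_sub_one hr.ne', Pi.neg_apply]
    ring
  have hcont : ContinuousOn h (Ioi 0) :=
    fun z hz => (hderiv z hz).continuousAt.continuousWithinAt
  have hint : ∀ r, 0 < r → IntegrableOn h (Ioi r) := by
    intro r hr
    refine (integrableOn_Ioi_rpow_of_lt (a := -(m * q)) (by linarith) hr).mono'
      ((hcont.mono (Ioi_subset_Ioi hr.le)).aestronglyMeasurable measurableSet_Ioi) ?_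
    filter_upwards [ae_restrict_mem measurableSet_Ioi] with z hz
    have hz0 : 0 < z := hr.trans hz
    rw [Real.norm_of_nonneg (hpos z hz0).le]
    exact hle z hz0
  have hφd : ∀ r, 0 < r → HasDerivAt φ (-h r) r := fun r hr =>
    (hasDerivAt_integral_Ioi_of_continuousOn hcont hint hr).congr_of_eventuallyEq
      (by filter_upwards [Ioi_mem_nhds hr] with x hx using hφ x hx)
  have hφt' : ∀ r, 0 < r → φt r = r / g r * h r := by
    intro r hr
    have hE : 0 ≤ Real.exp (g r) * r ^ m := by positivity
    rw [hφt r hr, mul_inv, inv_div, ← Real.rpow_neg hE]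
  set D : ℝ → ℝ := fun r => (r * g' r / g r - 1 + m * q) * (1 / g r) + r * g' r / g r * q with hD
  have hφtd : ∀ r, 0 < r → HasDerivAt φt (-h r * D r) r := by
    intro r hr
    have hg := (hgpos r hr).ne'
    have h1 := ((hasDerivAt_id r).div (hgd r hr) hg).mul (hderiv r hr)
    refine (h1.congr_of_eventuallyEq (f₁ := φt)
      (by filter_upwards [Ioi_mem_nhds hr] with x hx using hφt' x hx)).congr_deriv ?_
    simp only [hD, id, Pi.div_apply]
    field_simp
    ring
  have hDlow : ∀ r, 0 < r → (α₁ - 1 + m * q) * (1 / g r) + α₁ * q ≤ D r := by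
    intro r hr
    have hg := hgpos r hr
    have ht : α₁ ≤ r * g' r / g r := by
      have := hlow r hr
      rw [div_le_iff₀ hr] at this
      rw [le_div_iff₀ hg]
      linarith
    simp only [hD]
    gcongr
  have hDupp : ∀ r, 0 < r → D r ≤ (α₂ - 1 + m * q) * (1 / g r) + α₂ * q := by
    intro r hr
    have hg := hgpos r hr
    have ht : r * g' r / g r ≤ α₂ := by
      have := hupp r hr
      rw [le_div_iff₀ hr] at this
      rw [div_le_iff₀ hg]
      linarith
    simp only [hD]
    gcongr
  have hα₁le : ∀ r, 0 < r → α₁ * q ≤ (α₁ - 1 + m * q) * (1 / g r) + α₁ * q := by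
    intro r hr
    have hg := hgpos r hr
    have : 0 ≤ α₁ - 1 + m * q := by linarith
    have : 0 ≤ (α₁ - 1 + m * q) * (1 / g r) := by positivity
    linarith
  refine ⟨hint, fun r hr => ⟨-h r, -h r * D r, hφd r hr, hφtd r hr, hα₁le r hr, ?_, ?_⟩, ?_⟩
  · rw [mul_div_cancel_left₀ _ (neg_ne_zero.2 (hpos r hr).ne')]
    exact hDlow r hr
  · rw [mul_div_cancel_left₀ _ (neg_ne_zero.2 (hpos r hr).ne')]
    exact hDupp r hr
  intro s hs
  have hgs := hgpos s hs
  have hmono : MonotoneOn g (Ici s) := by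
    have hsub : ∀ x ∈ interior (Ici s), 0 < x := fun x hx => hs.trans_le (interior_subset hx)
    apply monotoneOn_of_hasDerivWithinAt_nonneg (f' := g') (convex_Ici s)
    · exact hgc.mono (Ici_subset_Ici.2 hs.le)
    · exact fun x hx => (hgd x (hsub x hx)).hasDerivWithinAt
    · intro x hx
      have hx0 := hsub x hx
      have := hgpos x hx0
      exact le_trans (by positivity) (hlow x hx0)
  have hφlim : Tendsto φ atTop (𝓝 0) := by
    refine (tendsto_integral_Ioi_zero (f := h) (μ := volume) tendsto_id).congr' ?_
    filter_upwards [eventually_gt_atTop 0] with x hx using (hφ x hx).symm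
  have hφtlim : Tendsto φt atTop (𝓝 0) := by
    have hbound : Tendsto (fun r : ℝ => 1 / g s * r ^ (-(m * q - 1))) atTop (𝓝 0) := by
      simpa using (tendsto_rpow_neg_atTop (y := m * q - 1) (by linarith)).const_mul (1 / g s)
    refine squeeze_zero' ?_ ?_ hbound
    · filter_upwards [eventually_gt_atTop 0] with r hr
      have := hgpos r hr
      have := hpos r hr
      rw [hφt' r hr]
      positivity
    · filter_upwards [eventually_ge_atTop s] with r hr
      have hr0 : 0 < r := hs.trans_le hr
      have hg := hmono self_mem_Ici hr hr
      rw [hφt' r hr0]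
      calc r / g r * h r ≤ r / g s * r ^ (-(m * q)) := by
            gcongr
            exact hle r hr0
        _ = 1 / g s * r ^ (-(m * q - 1)) := by
            rw [show -(m * q - 1) = -(m * q) + 1 by ring, Real.rpow_add_one hr0.ne']
            ring
  have hK : 0 < α₂ - 1 + m * q := by linarith
  have hα₂ : 0 < α₂ := by linarith
  refine ⟨α₁ * q, (α₂ - 1 + m * q) * (1 / g s) + α₂ * q, by positivity, by positivity,
    fun r hr => ⟨?_, ?_⟩⟩
  · refine sub_nonneg.1 (nonneg_of_hasDerivAt_nonpos_of_tendsto_zero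
      (F := fun x => φt x - α₁ * q * φ x) (F' := fun x => -h x * D x - α₁ * q * (-h x))
      (fun x hx => (hφtd x (hs.trans_le hx)).sub ((hφd x (hs.trans_le hx)).const_mul _))
      (fun x hx => ?_) (by simpa using hφtlim.sub (hφlim.const_mul (α₁ * q))) hr)
    have hx0 := hs.trans_le hx
    have := mul_nonneg (hpos x hx0).le (sub_nonneg.2 ((hα₁le x hx0).trans (hDlow x hx0)))
    linarith
  · set C := (α₂ - 1 + m * q) * (1 / g s) + α₂ * q with hC
    refine sub_nonneg.1 (nonneg_of_hasDerivAt_nonpos_of_tendsto_zero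
      (F := fun x => C * φ x - φt x) (F' := fun x => C * (-h x) - -h x * D x)
      (fun x hx => ((hφd x (hs.trans_le hx)).const_mul _).sub (hφtd x (hs.trans_le hx)))
      (fun x hx => ?_) (by simpa using (hφlim.const_mul C).sub hφtlim) hr)
    have hx0 := hs.trans_le hx
    have hg := hmono self_mem_Ici hx hx
    have hDC : D x ≤ C := (hDupp x hx0).trans (by rw [hC]; gcongr)
    have := mul_nonneg (hpos x hx0).le (sub_nonneg.2 hDC)
    linarith
end
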